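/- arXiv:1311.4524 — 2 statements merged into one kernel-verified Lean document; each statement's English description precedes it below -/
import Mathlib

section
/- Let T be a Chacon map with spacer sequence (s_j) such that for every value s, the level set I_s = {j : s_j = s} is an interval of consecutive integers, and |I_s| → ∞ as s → ∞. Then T possesses all polynomial weak limits of its powers: for every m ≥ 0, all natural numbers p_0 < p_1 < … < p_m, and all nonnegative reals a_0, …, a_m with a_0 + … + a_m = 1, there exists a sequence q(k) → ∞ such that for all measurable sets A, B ⊆ X, μ(T^{q(k)}A ∩ B) → Σ_{i=0}^m a_i μ(T^{p_i}A ∩ B) as k → ∞. -/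
open MeasureTheory Filter Topology
open scoped symmDiff

/-- A Chacon-type rank-one map (cutting into 3, spacer sequence `s` over the middle
column), acting on a probability space `(X, μ)`. -/
structure ChaconMap {X : Type*} [MeasurableSpace X]
    (μ : Measure X) (s : ℕ → ℕ) : Type _ where
  /-- The transformation, an invertible bimeasurable map. -/
  T : X ≃ᵐ X
  measurePreserving : MeasurePreserving T μ μ
  /-- The tower heights (number of levels is `h j + 1`). -/
  h : ℕ → ℕ
  h_one : h 1 = 1
  h_succ : ∀ j, 1 ≤ j → h (j + 1) = 3 * h j + 2 + s j
  /-- The base of the `j`-th tower. -/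
  E : ℕ → Set X
  E1 : ℕ → Set X
  E2 : ℕ → Set X
  E3 : ℕ → Set X
  measE : ∀ j, MeasurableSet (E j)
  measE1 : ∀ j, MeasurableSet (E1 j)
  measE2 : ∀ j, MeasurableSet (E2 j)
  measE3 : ∀ j, MeasurableSet (E3 j)
  /-- (i) the levels of the `j`-th tower are pairwise disjoint. -/
  tower_disjoint : ∀ j, 1 ≤ j → ∀ i ≤ h j, ∀ i' ≤ h j, i ≠ i' →
    Disjoint ((⇑T)^[i] '' E j) ((⇑T)^[i'] '' E j)
  /-- (ii) the base is cut into three pieces of equal measure. -/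
  E_union : ∀ j, 1 ≤ j → E j = E1 j ∪ E2 j ∪ E3 j
  E_disj12 : ∀ j, 1 ≤ j → Disjoint (E1 j) (E2 j)
  E_disj13 : ∀ j, 1 ≤ j → Disjoint (E1 j) (E3 j)
  E_disj23 : ∀ j, 1 ≤ j → Disjoint (E2 j) (E3 j)
  E_meas12 : ∀ j, 1 ≤ j → μ (E1 j) = μ (E2 j)
  E_meas23 : ∀ j, 1 ≤ j → μ (E2 j) = μ (E3 j)
  E_next : ∀ j, 1 ≤ j → E (j + 1) = E1 j
  /-- (iii) stacking: the top of the first column is sent to the base of the second. -/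
  stack1 : ∀ j, 1 ≤ j → μ (((⇑T)^[h j + 1] '' E1 j) ∆ E2 j) = 0
  /-- (iii) stacking: the top spacer over the second column is sent to the third base. -/
  stack2 : ∀ j, 1 ≤ j → μ (((⇑T)^[h j + 1 + s j] '' E2 j) ∆ E3 j) = 0
  /-- (iii) the spacer levels are disjoint from the `j`-th tower. -/
  spacer_disjoint : ∀ j, 1 ≤ j → ∀ i, 1 ≤ i → i ≤ s j → ∀ i' ≤ h j,
    Disjoint ((⇑T)^[h j + i] '' E2 j) ((⇑T)^[i'] '' E j)
  /-- (iv) the towers fill up the whole space. -/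
  tower_full : Tendsto (fun j => μ (⋃ i ∈ Finset.range (h j + 1), (⇑T)^[i] '' E j))
    atTop (𝓝 1)
  /-- (iv) the levels of the towers generate the full σ-algebra mod `μ`. -/
  generates : ∀ A : Set X, MeasurableSet A → ∃ B : Set X,
    MeasurableSet[MeasurableSpace.generateFrom
      {S : Set X | ∃ j, 1 ≤ j ∧ ∃ i ≤ h j, S = (⇑T)^[i] '' E j}] B ∧ μ (A ∆ B) = 0

set_option linter.unusedSectionVars false

namespace ChaconAux

/-- Integer powers of `T` acting on sets. -/
def pw {X : Type*} [MeasurableSpace X] (T : X ≃ᵐ X) (n : ℤ) (A : Set X) : Set X :=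
  ⇑((T.toEquiv : Equiv.Perm X) ^ n) '' A

section pw
variable {X : Type*} [MeasurableSpace X] (T : X ≃ᵐ X)

lemma pw_zero (A : Set X) : pw T 0 A = A := by simp [pw]

lemma pw_add (m n : ℤ) (A : Set X) : pw T (m + n) A = pw T m (pw T n A) := by
  simp [pw, zpow_add, Set.image_image]

lemma pw_one (A : Set X) : pw T 1 A = T '' A := by simp [pw]

lemma pw_neg_one (A : Set X) : pw T (-1) A = T ⁻¹' A := by
  have : pw T (-1) A = T.toEquiv.symm '' A := by
    simp only [pw, zpow_neg_one]; rfl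
  rw [this, Equiv.image_symm_eq_preimage]; rfl

lemma pw_nat (n : ℕ) (A : Set X) : (⇑T)^[n] '' A = pw T n A := by
  have : (⇑T)^[n] = ⇑((T.toEquiv : Equiv.Perm X) ^ n) := by
    rw [← Equiv.Perm.iterate_eq_pow]; rfl
  rw [this]; simp [pw]

lemma pw_inter (n : ℤ) (A B : Set X) : pw T n (A ∩ B) = pw T n A ∩ pw T n B :=
  Set.image_inter (Equiv.injective _)

lemma pw_union (n : ℤ) (A B : Set X) : pw T n (A ∪ B) = pw T n A ∪ pw T n B :=
  Set.image_union _ _ _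

lemma pw_iUnion {ι : Sort*} (n : ℤ) (A : ι → Set X) : pw T n (⋃ i, A i) = ⋃ i, pw T n (A i) :=
  Set.image_iUnion

lemma pw_sdiff (n : ℤ) (A B : Set X) : pw T n (A \ B) = pw T n A \ pw T n B :=
  Set.image_sdiff (Equiv.injective _) _ _

lemma pw_symmDiff (n : ℤ) (A B : Set X) : pw T n (A ∆ B) = pw T n A ∆ pw T n B :=
  Set.image_symmDiff (Equiv.injective _) _ _

lemma pw_mono (n : ℤ) {A B : Set X} (h : A ⊆ B) : pw T n A ⊆ pw T n B := Set.image_mono h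

lemma pw_disjoint (n : ℤ) {A B : Set X} (h : Disjoint A B) : Disjoint (pw T n A) (pw T n B) :=
  (Set.disjoint_image_iff (Equiv.injective _)).2 h

lemma pw_neg_pw (n : ℤ) (A : Set X) : pw T (-n) (pw T n A) = A := by
  rw [← pw_add, neg_add_cancel, pw_zero]

lemma pw_pw_neg (n : ℤ) (A : Set X) : pw T n (pw T (-n) A) = A := by
  rw [← pw_add, add_neg_cancel, pw_zero]

lemma pw_measurable (n : ℤ) {A : Set X} (hA : MeasurableSet A) : MeasurableSet (pw T n A) := by
  induction n using Int.induction_on with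
  | zero => rwa [pw_zero]
  | succ i ih => rw [add_comm, pw_add, pw_one]; exact T.measurableSet_image.2 ih
  | pred i ih =>
    rw [sub_eq_add_neg, add_comm, pw_add, pw_neg_one]; exact T.measurable ih

lemma pw_measure {T : X ≃ᵐ X} {μ : Measure X} (hT : MeasurePreserving T μ μ) (n : ℤ) (A : Set X) : μ (pw T n A) = μ A := by
  induction n using Int.induction_on with
  | zero => rw [pw_zero]
  | succ i ih =>
    rw [add_comm, pw_add, pw_one, ← ih]
    conv_rhs => rw [← hT.measure_preimage_equiv]
    rw [← hT.measure_preimage_equiv, Set.preimage_image_eq _ T.injective]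
    rw [hT.measure_preimage_equiv]
  | pred i ih =>
    rw [sub_eq_add_neg, add_comm, pw_add, pw_neg_one, ← ih]
    exact hT.measure_preimage_equiv _

end pw

/-- Correlation function `μ(T^n A ∩ B)`. -/
noncomputable def phi {X : Type*} [MeasurableSpace X] (μ : Measure X) (T : X ≃ᵐ X) (n : ℤ)
    (A B : Set X) : ℝ := μ.real (pw T n A ∩ B)

section phi
variable {X : Type*} [MeasurableSpace X] {μ : Measure X} [IsProbabilityMeasure μ] {T : X ≃ᵐ X}

lemma phi_nonneg (n : ℤ) (A B : Set X) : 0 ≤ phi μ T n A B := measureReal_nonneg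

lemma phi_le_one (n : ℤ) (A B : Set X) : phi μ T n A B ≤ 1 := measureReal_le_one

lemma phi_eq (hT : MeasurePreserving T μ μ) (n : ℤ) (A B : Set X) :
    phi μ T n A B = μ.real (A ∩ pw T (-n) B) := by
  unfold phi Measure.real
  rw [← pw_measure hT (-n) (pw T n A ∩ B), pw_inter, pw_neg_pw]

lemma phi_neg (hT : MeasurePreserving T μ μ) (n : ℤ) (A B : Set X) :
    phi μ T (-n) A B = phi μ T n B A := by
  rw [phi_eq hT, neg_neg, Set.inter_comm]; rfl

lemma phi_add (m n : ℤ) (A B : Set X) :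
    phi μ T (m + n) A B = phi μ T m (pw T n A) B := by
  unfold phi; rw [pw_add]

lemma real_inter_sub_le (A B A' B' : Set X) :
    μ.real (A ∩ B) ≤ μ.real (A' ∩ B') + (μ.real (A ∆ A') + μ.real (B ∆ B')) := by
  have h : A ∩ B ⊆ (A' ∩ B') ∪ ((A ∆ A') ∪ (B ∆ B')) := by
    intro x hx
    simp only [Set.mem_union, Set.mem_inter_iff, Set.mem_symmDiff] at *
    tauto
  calc μ.real (A ∩ B) ≤ μ.real ((A' ∩ B') ∪ ((A ∆ A') ∪ (B ∆ B'))) := measureReal_mono h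
    _ ≤ μ.real (A' ∩ B') + μ.real ((A ∆ A') ∪ (B ∆ B')) := measureReal_union_le _ _
    _ ≤ _ := by gcongr; exact measureReal_union_le _ _

lemma phi_approx (hT : MeasurePreserving T μ μ) (n : ℤ) (A B A' B' : Set X) :
    |phi μ T n A B - phi μ T n A' B'| ≤ μ.real (A ∆ A') + μ.real (B ∆ B') := by
  have e : μ.real (pw T n A ∆ pw T n A') = μ.real (A ∆ A') := by
    unfold Measure.real; rw [← pw_symmDiff, pw_measure hT]
  have h1 := real_inter_sub_le (μ := μ) (pw T n A) B (pw T n A') B'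
  have h2 := real_inter_sub_le (μ := μ) (pw T n A') B' (pw T n A) B
  rw [symmDiff_comm (pw T n A'), symmDiff_comm B'] at h2
  rw [e] at h1 h2
  unfold phi
  rw [abs_le]; constructor <;> linarith

end phi

/-- `L` is approximated to accuracy `δ` by `phi q` for some integer `q`. -/
def App {X : Type*} [MeasurableSpace X] (μ : Measure X) (T : X ≃ᵐ X)
    (L : Set X × Set X → ℝ) (δ : ℝ) : Prop :=
  ∀ F : Finset (Set X × Set X), (∀ x ∈ F, MeasurableSet x.1 ∧ MeasurableSet x.2) →
    ∃ q : ℤ, ∀ x ∈ F, |phi μ T q x.1 x.2 - L x| ≤ δ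

/-- `L` is approximated to accuracy `δ` by `phi q` for arbitrarily large and small `q`. -/
def Near {X : Type*} [MeasurableSpace X] (μ : Measure X) (T : X ≃ᵐ X)
    (L : Set X × Set X → ℝ) (δ : ℝ) : Prop :=
  ∀ F : Finset (Set X × Set X), (∀ x ∈ F, MeasurableSet x.1 ∧ MeasurableSet x.2) →
    ∀ N : ℤ, (∃ q : ℤ, N ≤ q ∧ ∀ x ∈ F, |phi μ T q x.1 x.2 - L x| ≤ δ) ∧
      (∃ q : ℤ, q ≤ -N ∧ ∀ x ∈ F, |phi μ T q x.1 x.2 - L x| ≤ δ)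

/-- The key property: `T^{K s}` is asymptotic to `(I + T^{-s}) / 2`. -/
def Key {X : Type*} [MeasurableSpace X] (μ : Measure X) (T : X ≃ᵐ X) (K : ℕ → ℕ) : Prop :=
  ∀ A B : Set X, MeasurableSet A → MeasurableSet B →
    Tendsto (fun s : ℕ => phi μ T (K s) A B - (phi μ T 0 A B + phi μ T (-(s : ℤ)) A B) / 2)
      atTop (𝓝 0)

section abstract_part
variable {X : Type*} [MeasurableSpace X] {μ : Measure X} [IsProbabilityMeasure μ] {T : X ≃ᵐ X}

lemma Near.app {L : Set X × Set X → ℝ} {δ : ℝ} (h : Near μ T L δ) : App μ T L δ := by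
  intro F hF
  obtain ⟨⟨q, -, hq⟩, -⟩ := h F hF 0
  exact ⟨q, hq⟩

lemma mid (hT : MeasurePreserving T μ μ) {K : ℕ → ℕ} (hK : Tendsto K atTop atTop)
    (key : Key μ T K) {L₁ L₂ : Set X × Set X → ℝ} {δ₁ δ₂ δ : ℝ}
    (h₁ : App μ T L₁ δ₁) (h₂ : Near μ T L₂ δ₂) (hδ : (δ₁ + δ₂) / 2 < δ) :
    Near μ T (fun x => (L₁ x + L₂ x) / 2) δ := by
  intro F hF N
  obtain ⟨n, hn⟩ := h₁ F hF
  set η := δ - (δ₁ + δ₂) / 2 with hη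
  have hη0 : 0 < η := by linarith
  have ev1 : ∀ᶠ s : ℕ in atTop, ∀ x ∈ F, |phi μ T (K s) (pw T n x.1) x.2 -
      (phi μ T 0 (pw T n x.1) x.2 + phi μ T (-(s : ℤ)) (pw T n x.1) x.2) / 2| < η := by
    rw [Filter.eventually_all_finset]
    intro x hx
    have := key (pw T n x.1) x.2 (pw_measurable T n (hF x hx).1) (hF x hx).2
    have := (Metric.tendsto_nhds.1 this) η hη0
    simpa [Real.dist_eq] using this
  have ev2 : ∀ᶠ s : ℕ in atTop, ∀ x ∈ F, |phi μ T (-(K s : ℤ)) (pw T n x.1) x.2 -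
      (phi μ T 0 (pw T n x.1) x.2 + phi μ T (s : ℤ) (pw T n x.1) x.2) / 2| < η := by
    rw [Filter.eventually_all_finset]
    intro x hx
    have := key x.2 (pw T n x.1) (hF x hx).2 (pw_measurable T n (hF x hx).1)
    have := (Metric.tendsto_nhds.1 this) η hη0
    filter_upwards [this] with s hs
    rw [Real.dist_eq, sub_zero] at hs
    have e0 := phi_neg (μ := μ) hT 0 (pw T n x.1) x.2
    rw [neg_zero] at e0
    rw [phi_neg hT, e0, ← phi_neg hT (s : ℤ) x.2]
    exact hs
  have ev3 := hK.eventually_ge_atTop (N + |n|).toNat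
  obtain ⟨s₀, hs₀⟩ := (ev1.and (ev2.and ev3)).exists_forall_of_atTop
  constructor
  · obtain ⟨-, m, hm, hmF⟩ := h₂ F hF (s₀ - n)
    obtain ⟨s, hs⟩ : ∃ s : ℕ, (s : ℤ) = n - m := ⟨(n - m).toNat, by omega⟩
    obtain ⟨g1, -, g3⟩ := hs₀ s (by omega)
    refine ⟨K s + n, ?_, ?_⟩
    · have := neg_abs_le n
      have := Int.self_le_toNat (N + |n|)
      omega
    · intro x hx
      have a1 := g1 x hx
      rw [← phi_add, ← phi_add, ← phi_add, zero_add,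
        show -(s : ℤ) + n = m by omega] at a1
      have a2 := hn x hx
      have a3 := hmF x hx
      rw [abs_le] at a2 a3 ⊢
      rw [abs_lt] at a1
      dsimp only
      constructor <;> linarith [a1.1, a1.2, a2.1, a2.2, a3.1, a3.2]
  · obtain ⟨⟨m, hm, hmF⟩, -⟩ := h₂ F hF (s₀ + n)
    obtain ⟨s, hs⟩ : ∃ s : ℕ, (s : ℤ) = m - n := ⟨(m - n).toNat, by omega⟩
    obtain ⟨-, g1, g3⟩ := hs₀ s (by omega)
    refine ⟨-K s + n, ?_, ?_⟩
    · have := le_abs_self n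
      have := Int.self_le_toNat (N + |n|)
      omega
    · intro x hx
      have a1 := g1 x hx
      rw [← phi_add, ← phi_add, ← phi_add, zero_add,
        show (s : ℤ) + n = m by omega] at a1
      have a2 := hn x hx
      have a3 := hmF x hx
      rw [abs_le] at a2 a3 ⊢
      rw [abs_lt] at a1
      dsimp only
      constructor <;> linarith [a1.1, a1.2, a2.1, a2.2, a3.1, a3.2]

/-- Rigidity. -/
lemma near_zero (hT : MeasurePreserving T μ μ) {K : ℕ → ℕ} (hK : Tendsto K atTop atTop)
    (key : Key μ T K) {δ : ℝ} (hδ : 0 < δ) : Near μ T (fun x => phi μ T 0 x.1 x.2) δ := by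
  have main : ∀ r : ℕ, ∀ δ : ℝ, (1 / 2 : ℝ) ^ r < δ →
      Near μ T (fun x => phi μ T 0 x.1 x.2) δ := by
    intro r
    induction r with
    | zero =>
      intro δ hδ F hF N
      have : ∀ q : ℤ, ∀ x ∈ F, |phi μ T q x.1 x.2 - phi μ T 0 x.1 x.2| ≤ δ := by
        intro q x _
        rw [pow_zero] at hδ
        have h1 := phi_nonneg (μ := μ) (T := T) q x.1 x.2
        have h2 := phi_le_one (μ := μ) (T := T) q x.1 x.2
        have h3 := phi_nonneg (μ := μ) (T := T) 0 x.1 x.2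
        have h4 := phi_le_one (μ := μ) (T := T) 0 x.1 x.2
        rw [abs_le]; constructor <;> linarith
      exact ⟨⟨N, le_rfl, this N⟩, ⟨-N, le_rfl, this _⟩⟩
    | succ r ih =>
      intro δ hδ
      have h1 : App μ T (fun x => phi μ T 0 x.1 x.2) 0 := fun F hF => ⟨0, by simp⟩
      have h2 := ih (δ + (1 / 2 : ℝ) ^ (r + 1)) (by rw [pow_succ] at hδ ⊢; linarith)
      have := mid hT hK key h1 h2 (δ := δ) (by linarith)
      simpa using this
  obtain ⟨r, hr⟩ := exists_pow_lt_of_lt_one hδ (by norm_num : (1 / 2 : ℝ) < 1)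
  exact main r δ hr

lemma near_shift (hT : MeasurePreserving T μ μ) {K : ℕ → ℕ} (hK : Tendsto K atTop atTop)
    (key : Key μ T K) (c : ℤ) {δ : ℝ} (hδ : 0 < δ) :
    Near μ T (fun x => phi μ T c x.1 x.2) δ := by
  classical
  intro F hF N
  have h := near_zero hT hK key hδ (F.image (fun x => (pw T c x.1, x.2))) (by
    intro x hx
    obtain ⟨y, hy, rfl⟩ := Finset.mem_image.1 hx
    exact ⟨pw_measurable T c (hF y hy).1, (hF y hy).2⟩) (N + |c|)
  have conv : ∀ q : ℤ, (∀ x ∈ F.image (fun x => (pw T c x.1, x.2)),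
      |phi μ T q x.1 x.2 - phi μ T 0 x.1 x.2| ≤ δ) →
      ∀ x ∈ F, |phi μ T (q + c) x.1 x.2 - phi μ T c x.1 x.2| ≤ δ := by
    intro q hq x hx
    have := hq _ (Finset.mem_image_of_mem _ hx)
    dsimp only at this
    rwa [← phi_add, ← phi_add, zero_add] at this
  obtain ⟨⟨q, hq, hqF⟩, ⟨q', hq', hqF'⟩⟩ := h
  exact ⟨⟨q + c, by linarith [neg_abs_le c], conv q hqF⟩,
    ⟨q' + c, by linarith [le_abs_self c], conv q' hqF'⟩⟩

/-- The set of all limit functionals. -/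
def limSet (μ : Measure X) (T : X ≃ᵐ X) : Set (Set X × Set X → ℝ) :=
  {L | (∀ x, 0 ≤ L x ∧ L x ≤ 1) ∧ ∀ δ > 0, Near μ T L δ}

lemma limSet_comb (hT : MeasurePreserving T μ μ) {K : ℕ → ℕ} (hK : Tendsto K atTop atTop)
    (key : Key μ T K) {L₁ L₂ : Set X × Set X → ℝ} (h₁ : L₁ ∈ limSet μ T) (h₂ : L₂ ∈ limSet μ T) :
    ∀ r : ℕ, ∀ t : ℝ, 0 ≤ t → t ≤ 1 → ∀ δ : ℝ, (1 / 2 : ℝ) ^ r < δ →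
      Near μ T (fun x => (1 - t) * L₁ x + t * L₂ x) δ := by
  intro r
  induction r with
  | zero =>
    intro t ht0 ht1 δ hδ F hF N
    have : ∀ q : ℤ, ∀ x ∈ F, |phi μ T q x.1 x.2 - ((1 - t) * L₁ x + t * L₂ x)| ≤ δ := by
      intro q x _
      rw [pow_zero] at hδ
      have g1 := phi_nonneg (μ := μ) (T := T) q x.1 x.2
      have g2 := phi_le_one (μ := μ) (T := T) q x.1 x.2
      obtain ⟨a1, a2⟩ := h₁.1 x
      obtain ⟨b1, b2⟩ := h₂.1 x
      have s0 : 0 ≤ 1 - t := by linarith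
      have g3 := mul_nonneg s0 a1
      have g4 := mul_nonneg ht0 b1
      have g5 := mul_le_mul_of_nonneg_left a2 s0
      have g6 := mul_le_mul_of_nonneg_left b2 ht0
      rw [abs_le]; constructor <;> linarith
    exact ⟨⟨N, le_rfl, this N⟩, ⟨-N, le_rfl, this _⟩⟩
  | succ r ih =>
    intro t ht0 ht1 δ hδ
    have hp : (0 : ℝ) < (1 / 2) ^ (r + 1) := by positivity
    have e : (1 / 2 : ℝ) ^ (r + 1) = (1 / 2 : ℝ) ^ r * (1 / 2) := pow_succ _ _
    rcases le_total t (1 / 2) with h | h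
    · have k := ih (2 * t) (by linarith) (by linarith) (δ + (1 / 2 : ℝ) ^ (r + 1)) (by linarith)
      have := mid hT hK key (h₁.2 ((δ - (1 / 2 : ℝ) ^ (r + 1)) / 2) (by linarith)).app k (δ := δ)
        (by linarith)
      convert this using 2 with x
      ring
    · have k := ih (2 * t - 1) (by linarith) (by linarith) (δ + (1 / 2 : ℝ) ^ (r + 1))
        (by linarith)
      have := mid hT hK key (h₂.2 ((δ - (1 / 2 : ℝ) ^ (r + 1)) / 2) (by linarith)).app k (δ := δ)
        (by linarith)
      convert this using 2 with x
      ring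

lemma limSet_convex (hT : MeasurePreserving T μ μ) {K : ℕ → ℕ} (hK : Tendsto K atTop atTop)
    (key : Key μ T K) : Convex ℝ (limSet μ T) := by
  intro L₁ h₁ L₂ h₂ u t hu ht hut
  obtain rfl : u = 1 - t := by linarith
  refine ⟨?_, ?_⟩
  · intro x
    obtain ⟨a1, a2⟩ := h₁.1 x
    obtain ⟨b1, b2⟩ := h₂.1 x
    have g3 := mul_nonneg hu a1
    have g4 := mul_nonneg ht b1
    have g5 := mul_le_mul_of_nonneg_left a2 hu
    have g6 := mul_le_mul_of_nonneg_left b2 ht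
    simp only [Pi.add_apply, Pi.smul_apply, smul_eq_mul]
    constructor <;> linarith
  · intro δ hδ
    obtain ⟨r, hr⟩ := exists_pow_lt_of_lt_one hδ (by norm_num : (1 / 2 : ℝ) < 1)
    exact limSet_comb hT hK key h₁ h₂ r t ht (by linarith) δ hr

lemma abstract_main (hT : MeasurePreserving T μ μ) {K : ℕ → ℕ} (hK : Tendsto K atTop atTop)
    (key : Key μ T K) (D : ℕ → Set X) (hD : ∀ n, MeasurableSet (D n))
    (dense : ∀ A : Set X, MeasurableSet A → ∀ ε > 0, ∃ n, μ.real (A ∆ D n) < ε)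
    (m : ℕ) (p : Fin (m + 1) → ℕ) (c : Fin (m + 1) → ℝ) (hc : ∀ i, 0 ≤ c i) (hc1 : ∑ i, c i = 1) :
    ∃ q : ℕ → ℕ, Tendsto q atTop atTop ∧ ∀ A B : Set X, MeasurableSet A → MeasurableSet B →
      Tendsto (fun k => phi μ T (q k) A B) atTop (𝓝 (∑ i, c i * phi μ T (p i) A B)) := by
  classical
  set L : Set X × Set X → ℝ := ∑ i, c i • (fun x => phi μ T (p i) x.1 x.2) with hLdef
  have hL : L ∈ limSet μ T := (limSet_convex hT hK key).sum_mem (fun i _ => hc i) hc1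
    (fun i _ => ⟨fun x => ⟨phi_nonneg _ _ _, phi_le_one _ _ _⟩,
      fun δ hδ => near_shift hT hK key _ hδ⟩)
  have hLx : ∀ A B, L (A, B) = ∑ i, c i * phi μ T (p i) A B := by
    intro A B; simp [hLdef, Finset.sum_apply]
  have hLapp : ∀ A B A' B', |L (A, B) - L (A', B')| ≤ μ.real (A ∆ A') + μ.real (B ∆ B') := by
    intro A B A' B'
    rw [hLx, hLx, ← Finset.sum_sub_distrib]
    calc |∑ i, (c i * phi μ T (p i) A B - c i * phi μ T (p i) A' B')|
        ≤ ∑ i, |c i * phi μ T (p i) A B - c i * phi μ T (p i) A' B'| :=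
          Finset.abs_sum_le_sum_abs _ _
      _ ≤ ∑ i, c i * (μ.real (A ∆ A') + μ.real (B ∆ B')) := by
          refine Finset.sum_le_sum fun i _ => ?_
          rw [← mul_sub, abs_mul, abs_of_nonneg (hc i)]
          exact mul_le_mul_of_nonneg_left (phi_approx hT _ _ _ _ _) (hc i)
      _ = _ := by rw [← Finset.sum_mul, hc1, one_mul]
  have hex : ∀ k : ℕ, ∃ q : ℕ, k ≤ q ∧ ∀ i ≤ k, ∀ l ≤ k,
      |phi μ T (q : ℤ) (D i) (D l) - L (D i, D l)| ≤ 1 / ((k : ℝ) + 1) := by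
    intro k
    obtain ⟨⟨q, hq, hqF⟩, -⟩ := hL.2 (1 / ((k : ℝ) + 1)) (by positivity)
      ((Finset.range (k + 1) ×ˢ Finset.range (k + 1)).image (fun y => (D y.1, D y.2))) (by
        intro x hx
        obtain ⟨y, -, rfl⟩ := Finset.mem_image.1 hx
        exact ⟨hD _, hD _⟩) k
    refine ⟨q.toNat, by omega, fun i hi l hl => ?_⟩
    rw [Int.toNat_of_nonneg (by omega)]
    exact hqF (D i, D l) (Finset.mem_image.2 ⟨(i, l), by simp; omega, rfl⟩)
  choose q hq hqD using hex
  refine ⟨q, tendsto_atTop_mono hq tendsto_id, fun A B hA hB => ?_⟩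
  rw [← hLx, Metric.tendsto_nhds]
  intro ε hε
  obtain ⟨i, hi⟩ := dense A hA (ε / 5) (by positivity)
  obtain ⟨l, hl⟩ := dense B hB (ε / 5) (by positivity)
  have ev := (tendsto_one_div_add_atTop_nhds_zero_nat (𝕜 := ℝ)).eventually_lt_const
    (show (0 : ℝ) < ε / 5 by positivity)
  filter_upwards [ev, eventually_ge_atTop i, eventually_ge_atTop l] with k h1 h2 h3
  have a1 := hqD k i h2 l h3
  have a2 := phi_approx hT (q k) A B (D i) (D l)
  have a3 := hLapp A B (D i) (D l)
  rw [Real.dist_eq, abs_lt]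
  rw [abs_le] at a1 a2 a3
  constructor <;> linarith [a1.1, a1.2, a2.1, a2.2, a3.1, a3.2]

end abstract_part

section chacon
variable {X : Type*} [MeasurableSpace X] {μ : Measure X} [IsProbabilityMeasure μ] {s : ℕ → ℕ}
  (C : ChaconMap μ s)

/-- Union of levels of the `j`-th tower. -/
def lev (j : ℕ) (S : Finset ℕ) : Set X := ⋃ i ∈ S, pw C.T i (C.E j)

lemma lev_measurable (j : ℕ) (S : Finset ℕ) : MeasurableSet (lev C j S) :=
  Finset.measurableSet_biUnion _ fun _ _ => pw_measurable _ _ (C.measE j)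

lemma real_inter_congr {A B : Set X} (h : μ (A ∆ B) = 0) (D : Set X) :
    μ.real (A ∩ D) = μ.real (B ∩ D) := by
  have h' : μ.real (A ∆ B) = 0 := by simp [Measure.real, h]
  have h1 := real_inter_sub_le (μ := μ) A D B D
  have h2 := real_inter_sub_le (μ := μ) B D A D
  rw [symmDiff_comm B A] at h2
  rw [h'] at h1 h2
  simp only [symmDiff_self, Set.bot_eq_empty, measureReal_empty, add_zero] at h1 h2
  linarith

lemma shift1 {j : ℕ} (hj : 1 ≤ j) (D : Set X) :
    μ.real (C.E1 j ∩ pw C.T (-((C.h j : ℤ) + 1)) D) = μ.real (C.E2 j ∩ D) := by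
  have h := C.stack1 j hj
  rw [pw_nat] at h
  rw [← phi_eq C.measurePreserving, ← real_inter_congr h]
  unfold phi; push_cast; rfl

lemma shift2 {j : ℕ} (hj : 1 ≤ j) (D : Set X) :
    μ.real (C.E2 j ∩ pw C.T (-((C.h j : ℤ) + 1 + s j)) D) = μ.real (C.E3 j ∩ D) := by
  have h := C.stack2 j hj
  rw [pw_nat] at h
  rw [← phi_eq C.measurePreserving, ← real_inter_congr h]
  unfold phi; push_cast; rfl

lemma split3 {j : ℕ} (hj : 1 ≤ j) {W : Set X} (hW : MeasurableSet W) :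
    μ.real (C.E j ∩ W) = μ.real (C.E1 j ∩ W) + μ.real (C.E2 j ∩ W) + μ.real (C.E3 j ∩ W) := by
  rw [C.E_union j hj, Set.union_inter_distrib_right, Set.union_inter_distrib_right,
    measureReal_union _ ((C.measE3 j).inter hW), measureReal_union _ ((C.measE2 j).inter hW)]
  · exact (C.E_disj12 j hj).mono Set.inter_subset_left Set.inter_subset_left
  · rw [Set.disjoint_union_left]
    exact ⟨(C.E_disj13 j hj).mono Set.inter_subset_left Set.inter_subset_left,
      (C.E_disj23 j hj).mono Set.inter_subset_left Set.inter_subset_left⟩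

lemma meas_third {j : ℕ} (hj : 1 ≤ j) :
    μ.real (C.E1 j) = μ.real (C.E j) / 3 ∧ μ.real (C.E2 j) = μ.real (C.E j) / 3 ∧
      μ.real (C.E3 j) = μ.real (C.E j) / 3 ∧ μ.real (C.E (j + 1)) = μ.real (C.E j) / 3 := by
  have h := split3 C hj MeasurableSet.univ
  simp only [Set.inter_univ] at h
  have h1 : μ.real (C.E1 j) = μ.real (C.E2 j) := by simp [Measure.real, C.E_meas12 j hj]
  have h2 : μ.real (C.E2 j) = μ.real (C.E3 j) := by simp [Measure.real, C.E_meas23 j hj]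
  rw [C.E_next j hj]
  refine ⟨?_, ?_, ?_, ?_⟩ <;> linarith

lemma sub1 {j : ℕ} (hj : 1 ≤ j) : C.E1 j ⊆ C.E j := by
  rw [C.E_union j hj]; exact fun x hx => Or.inl (Or.inl hx)
lemma sub2 {j : ℕ} (hj : 1 ≤ j) : C.E2 j ⊆ C.E j := by
  rw [C.E_union j hj]; exact fun x hx => Or.inl (Or.inr hx)
lemma sub3 {j : ℕ} (hj : 1 ≤ j) : C.E3 j ⊆ C.E j := by
  rw [C.E_union j hj]; exact fun x hx => Or.inr hx

/-- The recursion for the images of the base under `T^{h_j + 1}`. -/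
lemma step {j : ℕ} (hj : 1 ≤ j) {D : Set X} (hD : MeasurableSet D) :
    μ.real (C.E j ∩ pw C.T (-((C.h j : ℤ) + 1)) D) =
      μ.real (C.E2 j ∩ D) + μ.real (C.E3 j ∩ pw C.T (s j) D) +
        μ.real (C.E (j + 1) ∩ pw C.T (-((C.h (j + 1) : ℤ) + 1)) D) := by
  rw [split3 C hj (pw_measurable _ _ hD), shift1 C hj]
  congr 1
  · congr 1
    rw [← shift2 C hj, ← pw_add]
    congr 3; ring
  · rw [← shift2 C hj, ← pw_add, ← shift1 C hj, ← pw_add, C.E_next j hj, C.h_succ j hj]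
    congr 3; push_cast; ring

/-- All-or-nothing relation. -/
def AoN (E D : Set X) : Prop := E ⊆ D ∨ Disjoint E D

lemma AoN.third {E E' D : Set X} (h : AoN E D) (hE : E' ⊆ E) (hm : μ.real E' = μ.real E / 3) :
    μ.real (E' ∩ D) = μ.real (E ∩ D) / 3 := by
  rcases h with h | h
  · rw [Set.inter_eq_left.2 h, Set.inter_eq_left.2 (hE.trans h), hm]
  · rw [h.inter_eq, (h.mono_left hE).inter_eq]; simp

lemma run_est (v : ℕ) (L : ℕ) : ∀ j, 1 ≤ j → (∀ l < L, s (j + l) = v) → ∀ D : Set X,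
    MeasurableSet D → AoN (C.E j) D → AoN (C.E j) (pw C.T v D) →
    |μ.real (C.E j ∩ pw C.T (-((C.h j : ℤ) + 1)) D) -
      (μ.real (C.E j ∩ D) + μ.real (C.E j ∩ pw C.T v D)) / 2| ≤ μ.real (C.E j) * (1 / 3) ^ L := by
  induction L with
  | zero =>
    intro j hj _ D hD _ _
    have h1 : ∀ W : Set X, 0 ≤ μ.real (C.E j ∩ W) ∧ μ.real (C.E j ∩ W) ≤ μ.real (C.E j) :=
      fun W => ⟨measureReal_nonneg, measureReal_mono Set.inter_subset_left⟩
    have a := h1 D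
    have b := h1 (pw C.T v D)
    have c := h1 (pw C.T (-((C.h j : ℤ) + 1)) D)
    rw [pow_zero, mul_one, abs_le]
    constructor <;> linarith [a.1, a.2, b.1, b.2, c.1, c.2]
  | succ L ih =>
    intro j hj hs D hD h1 h2
    have hsv : s j = v := by simpa using hs 0 (by omega)
    have hsub : C.E (j + 1) ⊆ C.E j := by rw [C.E_next j hj]; exact sub1 C hj
    obtain ⟨-, m2, m3, m4⟩ := meas_third C hj
    have mono : ∀ {W : Set X}, AoN (C.E j) W → AoN (C.E (j + 1)) W := by
      intro W h
      rcases h with h | h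
      · exact Or.inl (hsub.trans h)
      · exact Or.inr (h.mono_left hsub)
    have := ih (j + 1) (by omega) (fun l hl => by
      rw [← hs (l + 1) (by omega)]; congr 1; ring) D hD (mono h1) (mono h2)
    rw [step C hj hD, hsv, h1.third (sub2 C hj) m2, h2.third (sub3 C hj) m3]
    rw [h1.third hsub m4, h2.third hsub m4, m4] at this
    rw [show μ.real (C.E j) * (1 / 3 : ℝ) ^ (L + 1) = μ.real (C.E j) / 3 * (1 / 3) ^ L by
      rw [pow_succ]; ring]
    rw [abs_le] at this ⊢
    constructor <;> linarith [this.1, this.2]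

lemma lev_disj {j : ℕ} (hj : 1 ≤ j) {i i' : ℕ} (hi : i < C.h j + 1) (hi' : i' < C.h j + 1)
    (h : i ≠ i') : Disjoint (pw C.T i (C.E j)) (pw C.T i' (C.E j)) := by
  have := C.tower_disjoint j hj i (by omega) i' (by omega) h
  rwa [pw_nat, pw_nat] at this

lemma lev_AoN {j : ℕ} (hj : 1 ≤ j) {i : ℕ} (hi : i < C.h j + 1) {S : Finset ℕ}
    (hS : S ⊆ Finset.range (C.h j + 1)) : AoN (pw C.T i (C.E j)) (lev C j S) := by
  by_cases h : i ∈ S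
  · exact Or.inl (Set.subset_biUnion_of_mem (u := fun i : ℕ => pw C.T i (C.E j)) h)
  · refine Or.inr ?_
    unfold lev
    rw [Set.disjoint_iUnion₂_right]
    intro i' hi'
    exact lev_disj C hj hi (Finset.mem_range.1 (hS hi')) (by rintro rfl; exact h hi')

lemma AoN.pw {E D : Set X} (T : X ≃ᵐ X) (n : ℤ) (h : AoN E D) :
    AoN (pw T n E) (pw T n D) := by
  rcases h with h | h
  · exact Or.inl (pw_mono T n h)
  · exact Or.inr (pw_disjoint T n h)

lemma phi_lev {j : ℕ} (hj : 1 ≤ j) {S : Finset ℕ} (hS : S ⊆ Finset.range (C.h j + 1))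
    (n : ℤ) {B : Set X} (hB : MeasurableSet B) :
    phi μ C.T n (lev C j S) B = ∑ i ∈ S, μ.real (C.E j ∩ pw C.T (-n) (pw C.T (-(i : ℤ)) B)) := by
  rw [phi_eq C.measurePreserving]
  have : lev C j S ∩ pw C.T (-n) B = ⋃ i ∈ S, (pw C.T i (C.E j) ∩ pw C.T (-n) B) := by
    unfold lev; rw [Set.iUnion₂_inter]
  rw [this, measureReal_biUnion_finset]
  · refine Finset.sum_congr rfl fun i _ => ?_
    rw [show μ.real (pw C.T i (C.E j) ∩ pw C.T (-n) B) = phi μ C.T i (C.E j) (pw C.T (-n) B) from rfl,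
      phi_eq C.measurePreserving, ← pw_add, ← pw_add, add_comm]
  · intro i hi i' hi' h
    exact (lev_disj C hj (Finset.mem_range.1 (hS hi)) (Finset.mem_range.1 (hS hi')) h).mono
      Set.inter_subset_left Set.inter_subset_left
  · intro i _
    exact (pw_measurable _ _ (C.measE j)).inter (pw_measurable _ _ hB)

lemma tower_measure {j : ℕ} (hj : 1 ≤ j) :
    μ.real (lev C j (Finset.range (C.h j + 1))) = ((C.h j : ℝ) + 1) * μ.real (C.E j) := by
  have := phi_lev C hj (Finset.Subset.refl _) 0 MeasurableSet.univ
  have hu : ∀ n : ℤ, pw C.T n Set.univ = Set.univ := by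
    intro n; unfold ChaconAux.pw; simp
  simp only [phi, pw_zero, hu, Set.inter_univ, Finset.sum_const, Finset.card_range,
    nsmul_eq_mul] at this
  rw [this]; push_cast; ring

lemma tower_tendsto :
    Tendsto (fun j => ((C.h j : ℝ) + 1) * μ.real (C.E j)) atTop (𝓝 1) := by
  have h := (ENNReal.tendsto_toReal ENNReal.one_ne_top).comp C.tower_full
  rw [ENNReal.toReal_one] at h
  refine h.congr' ?_
  filter_upwards [eventually_ge_atTop 1] with j hj
  rw [← tower_measure C hj]
  simp only [Function.comp, lev, Measure.real, pw_nat]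

lemma spacer_tendsto : Tendsto (fun j => (s j : ℝ) * μ.real (C.E j)) atTop (𝓝 0) := by
  have h1 := tower_tendsto C
  have h2 := h1.comp (tendsto_add_atTop_nat 1)
  have h3 := (h2.sub h1).const_mul 3
  rw [sub_self, mul_zero] at h3
  refine h3.congr' ?_
  filter_upwards [eventually_ge_atTop 1] with j hj
  simp only [Function.comp]
  rw [(meas_third C hj).2.2.2, C.h_succ j hj]
  push_cast; ring

/-- Estimate for unions of levels. -/
lemma lev_est {j L v : ℕ} (hj : 1 ≤ j) (hs : ∀ l < L, s (j + l) = v) {S S' : Finset ℕ}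
    (hS : S ⊆ Finset.range (C.h j + 1)) (hS' : S' ⊆ Finset.range (C.h j + 1)) :
    |phi μ C.T ((C.h j + 1 : ℕ) : ℤ) (lev C j S) (lev C j S') -
      (phi μ C.T 0 (lev C j S) (lev C j S') +
        phi μ C.T (-(v : ℤ)) (lev C j S) (lev C j S')) / 2| ≤
      (1 / 3) ^ L + v * μ.real (C.E j) := by
  set B := lev C j S' with hBdef
  have hB : MeasurableSet B := lev_measurable C j S'
  set e := μ.real (C.E j) with he
  have he0 : 0 ≤ e := measureReal_nonneg
  rw [phi_lev C hj hS _ hB, phi_lev C hj hS _ hB, phi_lev C hj hS _ hB]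
  simp only [neg_zero, neg_neg, pw_zero]
  rw [← Finset.sum_add_distrib, Finset.sum_div, ← Finset.sum_sub_distrib]
  have term : ∀ i ∈ S, |μ.real (C.E j ∩ pw C.T (-((C.h j + 1 : ℕ) : ℤ)) (pw C.T (-(i : ℤ)) B)) -
      (μ.real (C.E j ∩ pw C.T (-(i : ℤ)) B) +
        μ.real (C.E j ∩ pw C.T v (pw C.T (-(i : ℤ)) B))) / 2| ≤
      e * (1 / 3) ^ L + if i < v then e else 0 := by
    intro i hi
    have hi' : i < C.h j + 1 := Finset.mem_range.1 (hS hi)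
    split_ifs with hiv
    · have h1 : ∀ W : Set X, 0 ≤ μ.real (C.E j ∩ W) ∧ μ.real (C.E j ∩ W) ≤ e :=
        fun W => ⟨measureReal_nonneg, measureReal_mono Set.inter_subset_left⟩
      have a := h1 (pw C.T (-(i : ℤ)) B)
      have b := h1 (pw C.T v (pw C.T (-(i : ℤ)) B))
      have c := h1 (pw C.T (-((C.h j + 1 : ℕ) : ℤ)) (pw C.T (-(i : ℤ)) B))
      have d : 0 ≤ e * (1 / 3 : ℝ) ^ L := by positivity
      rw [abs_le]
      constructor <;> linarith [a.1, a.2, b.1, b.2, c.1, c.2]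
    · rw [add_zero]
      have r := run_est C v L j hj hs (pw C.T (-(i : ℤ)) B) (pw_measurable _ _ hB) ?_ ?_
      · push_cast; exact r
      · have := (lev_AoN C hj hi' hS').pw C.T (-(i : ℤ))
        rwa [pw_neg_pw] at this
      · have := (lev_AoN C hj (show i - v < C.h j + 1 by omega) hS').pw C.T
          (-((i - v : ℕ) : ℤ))
        rw [pw_neg_pw] at this
        rw [← pw_add]
        convert this using 2
        omega
  calc _ ≤ ∑ i ∈ S, (e * (1 / 3) ^ L + if i < v then e else 0) :=
        (Finset.abs_sum_le_sum_abs _ _).trans (Finset.sum_le_sum term)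
    _ = S.card * (e * (1 / 3) ^ L) + ∑ i ∈ S, if i < v then e else 0 := by
        rw [Finset.sum_add_distrib, Finset.sum_const, nsmul_eq_mul]
    _ ≤ (1 / 3) ^ L + v * e := by
        apply add_le_add
        · have h1 : ((C.h j : ℝ) + 1) * e ≤ 1 := by
            rw [he, ← tower_measure C hj]; exact measureReal_le_one
          have h2 : (S.card : ℝ) ≤ (C.h j : ℝ) + 1 := by
            have := Finset.card_le_card hS
            rw [Finset.card_range] at this
            exact_mod_cast this
          have h3 : (S.card : ℝ) * e ≤ 1 := (mul_le_mul_of_nonneg_right h2 he0).trans h1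
          calc (S.card : ℝ) * (e * (1 / 3) ^ L) = (S.card * e) * (1 / 3) ^ L := by ring
            _ ≤ 1 * (1 / 3) ^ L := by gcongr
            _ = _ := one_mul _
        · rw [← Finset.sum_filter, Finset.sum_const, nsmul_eq_mul]
          have : (S.filter (· < v)).card ≤ v := by
            calc _ ≤ (Finset.range v).card := Finset.card_le_card (fun i hi => by
                  simp at hi ⊢; exact hi.2)
              _ = v := Finset.card_range v
          gcongr

/-! Density of unions of levels. -/

lemma pw_ae {A B : Set X} (n : ℤ) (h : A =ᵐ[μ] B) : pw C.T n A =ᵐ[μ] pw C.T n B := by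
  rw [← measure_symmDiff_eq_zero_iff] at h ⊢
  rw [← pw_symmDiff, pw_measure C.measurePreserving, h]

lemma base_ae {j : ℕ} (hj : 1 ≤ j) : (C.E j : Set X) =ᵐ[μ]
    (C.E (j + 1) ∪ pw C.T ((C.h j + 1 : ℕ) : ℤ) (C.E (j + 1)) ∪
      pw C.T ((2 * (C.h j + 1) + s j : ℕ) : ℤ) (C.E (j + 1)) : Set X) := by
  have h1 := C.stack1 j hj
  have h2 := C.stack2 j hj
  rw [pw_nat, measure_symmDiff_eq_zero_iff] at h1 h2
  have h3 := (pw_ae C ((C.h j + 1 + s j : ℕ) : ℤ) h1).trans h2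
  rw [← pw_add] at h3
  rw [C.E_union j hj, C.E_next j hj]
  have e : ((C.h j + 1 + s j : ℕ) : ℤ) + ((C.h j + 1 : ℕ) : ℤ) =
    ((2 * (C.h j + 1) + s j : ℕ) : ℤ) := by push_cast; ring
  rw [e] at h3
  exact ((Filter.EventuallyEq.refl _ _).union h1.symm).union h3.symm

lemma lev_succ {j : ℕ} (hj : 1 ≤ j) {S : Finset ℕ} (hS : S ⊆ Finset.range (C.h j + 1)) :
    ∃ S' ⊆ Finset.range (C.h (j + 1) + 1), (lev C j S : Set X) =ᵐ[μ] lev C (j + 1) S' := by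
  classical
  refine ⟨S ∪ S.image (· + (C.h j + 1)) ∪ S.image (· + (2 * (C.h j + 1) + s j)), ?_, ?_⟩
  · have hh := C.h_succ j hj
    have : ∀ i ∈ S, i < C.h j + 1 := fun i hi => Finset.mem_range.1 (hS hi)
    intro i hi
    simp only [Finset.mem_union, Finset.mem_image, Finset.mem_range] at hi ⊢
    rcases hi with (hi | ⟨k, hk, rfl⟩) | ⟨k, hk, rfl⟩
    · have := this i hi; omega
    · have := this k hk; omega
    · have := this k hk; omega
  · have key : (lev C j S : Set X) =ᵐ[μ] (⋃ i ∈ S, pw C.T i (C.E (j + 1) ∪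
        pw C.T ((C.h j + 1 : ℕ) : ℤ) (C.E (j + 1)) ∪
        pw C.T ((2 * (C.h j + 1) + s j : ℕ) : ℤ) (C.E (j + 1))) : Set X) :=
      Filter.EventuallyEq.countable_bUnion S.countable_toSet
        (fun i _ => pw_ae C i (base_ae C hj))
    refine key.trans (Filter.EventuallyEq.of_eq ?_)
    unfold lev
    rw [Finset.set_biUnion_union, Finset.set_biUnion_union, Finset.set_biUnion_finset_image,
      Finset.set_biUnion_finset_image]
    simp only [pw_union, ← pw_add, Set.iUnion_union_distrib, ← Nat.cast_add]
    rfl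


lemma lev_lift {j : ℕ} (hj : 1 ≤ j) {S : Finset ℕ} (hS : S ⊆ Finset.range (C.h j + 1)) (k : ℕ) :
    ∃ S' ⊆ Finset.range (C.h (j + k) + 1), (lev C j S : Set X) =ᵐ[μ] lev C (j + k) S' := by
  induction k with
  | zero => exact ⟨S, hS, Filter.EventuallyEq.rfl⟩
  | succ k ih =>
    obtain ⟨S', h1, h2⟩ := ih
    obtain ⟨S'', h3, h4⟩ := lev_succ C (j := j + k) (by omega) h1
    exact ⟨S'', h3, h2.trans h4⟩

/-- Sets approximable by unions of levels of all late towers. -/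
def Dense (A : Set X) : Prop := ∀ ε > (0 : ℝ), ∃ j₀, ∀ j ≥ j₀,
  ∃ S ⊆ Finset.range (C.h j + 1), μ.real (A ∆ lev C j S) < ε

lemma real_symmDiff_triangle (A B D : Set X) :
    μ.real (A ∆ D) ≤ μ.real (A ∆ B) + μ.real (B ∆ D) :=
  (measureReal_mono (symmDiff_triangle A B D)).trans (measureReal_union_le _ _)

lemma dense_congr {A B : Set X} (h : μ (A ∆ B) = 0) (hB : Dense C B) : Dense C A := by
  intro ε hε
  obtain ⟨j₀, h0⟩ := hB ε hε
  refine ⟨j₀, fun j hj => ?_⟩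
  obtain ⟨S, hS, h1⟩ := h0 j hj
  refine ⟨S, hS, ?_⟩
  have h2 := real_symmDiff_triangle (μ := μ) A B (lev C j S)
  have h3 : μ.real (A ∆ B) = 0 := by simp [Measure.real, h]
  linarith

lemma dense_union {A B : Set X} (hA : Dense C A) (hB : Dense C B) : Dense C (A ∪ B) := by
  classical
  intro ε hε
  obtain ⟨j₁, h1⟩ := hA (ε / 2) (by positivity)
  obtain ⟨j₂, h2⟩ := hB (ε / 2) (by positivity)
  refine ⟨max j₁ j₂, fun j hj => ?_⟩
  obtain ⟨S₁, hS₁, g1⟩ := h1 j (le_trans (le_max_left _ _) hj)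
  obtain ⟨S₂, hS₂, g2⟩ := h2 j (le_trans (le_max_right _ _) hj)
  refine ⟨S₁ ∪ S₂, Finset.union_subset hS₁ hS₂, ?_⟩
  have e : lev C j (S₁ ∪ S₂) = lev C j S₁ ∪ lev C j S₂ := by
    unfold lev; rw [Finset.set_biUnion_union]
  have sub : (A ∪ B) ∆ lev C j (S₁ ∪ S₂) ⊆ (A ∆ lev C j S₁) ∪ (B ∆ lev C j S₂) := by
    rw [e]; intro x hx
    simp only [Set.mem_union, Set.mem_symmDiff] at *
    tauto
  have := (measureReal_mono (μ := μ) sub).trans (measureReal_union_le _ _)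
  linarith

lemma dense_compl {A : Set X} (hA : Dense C A) : Dense C Aᶜ := by
  classical
  intro ε hε
  obtain ⟨j₁, h1⟩ := hA (ε / 2) (by positivity)
  obtain ⟨j₂, h2⟩ := eventually_atTop.1 ((tower_tendsto C).eventually_const_lt
    (show 1 - ε / 2 < 1 by linarith))
  refine ⟨max 1 (max j₁ j₂), fun j hj => ?_⟩
  have hj1 : 1 ≤ j := le_trans (le_max_left _ _) hj
  obtain ⟨S, hS, g1⟩ := h1 j (by omega)
  have g2 := h2 j (by omega)
  rw [← tower_measure C hj1] at g2
  set W := lev C j (Finset.range (C.h j + 1))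
  refine ⟨Finset.range (C.h j + 1) \ S, Finset.sdiff_subset, ?_⟩
  have d : Disjoint (lev C j (Finset.range (C.h j + 1) \ S)) (lev C j S) := by
    unfold lev
    rw [Set.disjoint_iUnion₂_left]; intro i hi
    rw [Set.disjoint_iUnion₂_right]; intro i' hi'
    simp only [Finset.mem_sdiff, Finset.mem_range] at hi
    exact lev_disj C hj1 hi.1 (Finset.mem_range.1 (hS hi')) (by rintro rfl; exact hi.2 hi')
  have u : W = lev C j (Finset.range (C.h j + 1) \ S) ∪ lev C j S := by
    unfold lev; rw [← Finset.set_biUnion_union, Finset.sdiff_union_of_subset hS]; rfl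
  have sub : Aᶜ ∆ lev C j (Finset.range (C.h j + 1) \ S) ⊆ (A ∆ lev C j S) ∪ Wᶜ := by
    rw [u]; intro x hx
    have : x ∈ lev C j (Finset.range (C.h j + 1) \ S) → x ∉ lev C j S :=
      fun h => Set.disjoint_left.1 d h
    simp only [Set.mem_union, Set.mem_symmDiff, Set.mem_compl_iff] at *
    tauto
  have m := (measureReal_mono (μ := μ) sub).trans (measureReal_union_le _ _)
  rw [probReal_compl_eq_one_sub (lev_measurable C j _)] at m
  linarith

lemma dense_empty : Dense C ∅ := by
  intro ε hε
  exact ⟨0, fun j _ => ⟨∅, Finset.empty_subset _, by simp [lev, hε]⟩⟩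

lemma dense_iUnion {f : ℕ → Set X} (hm : ∀ n, MeasurableSet (f n)) (hf : ∀ n, Dense C (f n)) :
    Dense C (⋃ n, f n) := by
  intro ε hε
  have hacc : ∀ n, Dense C (Set.accumulate f n) := by
    intro n
    induction n with
    | zero => simpa [Set.accumulate_zero_nat] using hf 0
    | succ n ih => rw [Set.accumulate_succ]; exact dense_union C ih (hf _)
  have ht : Tendsto (fun n => μ.real (Set.accumulate f n)) atTop (𝓝 (μ.real (⋃ n, f n))) :=
    (ENNReal.tendsto_toReal (measure_ne_top _ _)).comp tendsto_measure_iUnion_accumulate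
  obtain ⟨n, hn⟩ := (ht.eventually_const_lt
    (show μ.real (⋃ n, f n) - ε / 2 < μ.real (⋃ n, f n) by linarith)).exists
  obtain ⟨j₀, h0⟩ := hacc n (ε / 2) (by positivity)
  refine ⟨j₀, fun j hj => ?_⟩
  obtain ⟨S, hS, h1⟩ := h0 j hj
  refine ⟨S, hS, ?_⟩
  have hsub : Set.accumulate f n ⊆ ⋃ n, f n := Set.accumulate_subset_iUnion n
  have h2 := real_symmDiff_triangle (μ := μ) (⋃ n, f n) (Set.accumulate f n) (lev C j S)
  have h3 : μ.real ((⋃ n, f n) ∆ Set.accumulate f n) =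
      μ.real (⋃ n, f n) - μ.real (Set.accumulate f n) := by
    rw [symmDiff_of_ge hsub, measureReal_sdiff hsub (by
      unfold Set.accumulate; exact MeasurableSet.biUnion (Set.to_countable _) fun i _ => hm i)]
  linarith

lemma dense_level {j i : ℕ} (hj : 1 ≤ j) (hi : i ≤ C.h j) : Dense C (pw C.T i (C.E j)) := by
  intro ε hε
  refine ⟨j, fun k hk => ?_⟩
  obtain ⟨S, hS, h⟩ := lev_lift C hj (S := {i}) (by simp; omega) (k - j)
  rw [Nat.add_sub_cancel' hk] at hS h
  refine ⟨S, hS, ?_⟩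
  have e : lev C j {i} = pw C.T i (C.E j) := by simp [lev]
  rw [e, ← measure_symmDiff_eq_zero_iff] at h
  simp [Measure.real, h, hε]

lemma dense_all {A : Set X} (hA : MeasurableSet A) : Dense C A := by
  obtain ⟨B, hB, h⟩ := C.generates A hA
  refine dense_congr C h ?_
  have : MeasurableSet B ∧ Dense C B := by
    refine MeasurableSpace.generateFrom_induction
      {S : Set X | ∃ j, 1 ≤ j ∧ ∃ i ≤ C.h j, S = (⇑C.T)^[i] '' C.E j}
      (fun B _ => MeasurableSet B ∧ Dense C B) ?_ ?_ ?_ ?_ B hB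
    · rintro t ⟨j, hj, i, hi, rfl⟩ _
      rw [pw_nat]
      exact ⟨pw_measurable _ _ (C.measE j), dense_level C hj hi⟩
    · exact ⟨MeasurableSet.empty, dense_empty C⟩
    · rintro t _ ⟨h1, h2⟩
      exact ⟨h1.compl, dense_compl C h2⟩
    · intro f _ hf
      exact ⟨MeasurableSet.iUnion fun n => (hf n).1,
        dense_iUnion C (fun n => (hf n).1) (fun n => (hf n).2)⟩
  exact this.2

end chacon

section final
variable {X : Type*} [MeasurableSpace X] {μ : Measure X} [IsProbabilityMeasure μ] {s : ℕ → ℕ}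
  (C : ChaconMap μ s)

lemma exists_dense_seq {s : ℕ → ℕ} (C : ChaconMap μ s) : ∃ D : ℕ → Set X, (∀ n, MeasurableSet (D n)) ∧
    ∀ A : Set X, MeasurableSet A → ∀ ε > 0, ∃ n, μ.real (A ∆ D n) < ε := by
  obtain ⟨e, he⟩ := exists_surjective_nat (ℕ × Finset ℕ)
  refine ⟨fun n => lev C (e n).1 (e n).2, fun n => lev_measurable C _ _, fun A hA ε hε => ?_⟩
  obtain ⟨j, h⟩ := dense_all C hA ε hε
  obtain ⟨S, -, hS⟩ := h j le_rfl
  obtain ⟨n, hn⟩ := he (j, S)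
  exact ⟨n, by simpa [hn] using hS⟩

lemma start_tendsto (a b : ℕ → ℕ) (hinterval : ∀ v : ℕ, {j : ℕ | s j = v} = Set.Ico (a v) (b v))
    (hlen : Tendsto (fun v => b v - a v) atTop atTop) : Tendsto a atTop atTop := by
  rw [tendsto_atTop]
  intro N
  filter_upwards [hlen.eventually_ge_atTop 1,
    eventually_gt_atTop ((Finset.range N).sup s)] with v h1 h2
  by_contra! h
  have : a v ∈ {j : ℕ | s j = v} := by
    rw [hinterval]; exact ⟨le_rfl, by omega⟩
  have h3 : s (a v) = v := this
  have := Finset.le_sup (f := s) (Finset.mem_range.2 h)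
  omega

lemma le_height {j : ℕ} (hj : 1 ≤ j) : j ≤ C.h j := by
  induction j, hj using Nat.le_induction with
  | base => rw [C.h_one]
  | succ j hj ih => rw [C.h_succ j hj]; omega

lemma height_tendsto (a b : ℕ → ℕ)
    (hinterval : ∀ v : ℕ, {j : ℕ | s j = v} = Set.Ico (a v) (b v))
    (hlen : Tendsto (fun v => b v - a v) atTop atTop) :
    Tendsto (fun v => C.h (a v) + 1) atTop atTop := by
  have h := start_tendsto a b hinterval hlen
  refine tendsto_atTop_mono' _ ?_ h
  filter_upwards [h.eventually_ge_atTop 1] with v hv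
  have := le_height C hv
  omega

lemma key (a b : ℕ → ℕ) (hinterval : ∀ v : ℕ, {j : ℕ | s j = v} = Set.Ico (a v) (b v))
    (hlen : Tendsto (fun v => b v - a v) atTop atTop) :
    Key μ C.T (fun v => C.h (a v) + 1) := by
  intro A B hA hB
  have ha := start_tendsto a b hinterval hlen
  rw [Metric.tendsto_nhds]
  intro ε hε
  obtain ⟨j₁, h1⟩ := dense_all C hA (ε / 8) (by positivity)
  obtain ⟨j₂, h2⟩ := dense_all C hB (ε / 8) (by positivity)
  have e3 : ∀ᶠ v in atTop, (1 / 3 : ℝ) ^ (b v - a v) < ε / 8 :=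
    ((tendsto_pow_atTop_nhds_zero_of_lt_one (by norm_num : (0 : ℝ) ≤ 1 / 3)
      (by norm_num)).comp hlen).eventually_lt_const (show (0 : ℝ) < ε / 8 by positivity)
  have e4 : ∀ᶠ v in atTop, (s (a v) : ℝ) * μ.real (C.E (a v)) < ε / 8 :=
    ((spacer_tendsto C).comp ha).eventually_lt_const (show (0 : ℝ) < ε / 8 by positivity)
  filter_upwards [e3, e4, ha.eventually_ge_atTop 1, ha.eventually_ge_atTop j₁,
    ha.eventually_ge_atTop j₂, hlen.eventually_ge_atTop 1] with v g3 g4 g5 g6 g7 g8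
  obtain ⟨S, hS, k1⟩ := h1 (a v) g6
  obtain ⟨S', hS', k2⟩ := h2 (a v) g7
  have hs : ∀ l < b v - a v, s (a v + l) = v := by
    intro l hl
    have : a v + l ∈ {j : ℕ | s j = v} := by
      rw [hinterval]; exact ⟨by omega, by omega⟩
    exact this
  have hsv : s (a v) = v := by simpa using hs 0 (by omega)
  rw [hsv] at g4
  have est := lev_est C g5 hs hS hS'
  have p1 := phi_approx C.measurePreserving ((C.h (a v) + 1 : ℕ) : ℤ) A B
    (lev C (a v) S) (lev C (a v) S')
  have p2 := phi_approx C.measurePreserving 0 A B (lev C (a v) S) (lev C (a v) S')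
  have p3 := phi_approx C.measurePreserving (-(v : ℤ)) A B (lev C (a v) S) (lev C (a v) S')
  rw [Real.dist_eq, sub_zero, abs_lt]
  rw [abs_le] at est p1 p2 p3
  constructor <;>
    linarith [est.1, est.2, p1.1, p1.2, p2.1, p2.2, p3.1, p3.2]

end final

end ChaconAux

/-- if every level set `I_v = {j : s j = v}` of the spacer sequence is an
interval of consecutive integers whose length tends to infinity, then the Chacon map
possesses all polynomial weak limits of its powers. -/
theorem chacon_all_polynomial_weak_limits_of_long_intervals
    {X : Type*} [MeasurableSpace X] (μ : Measure X) [IsProbabilityMeasure μ]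
    (s : ℕ → ℕ) (C : ChaconMap μ s)
    (a b : ℕ → ℕ) (hinterval : ∀ v : ℕ, {j : ℕ | s j = v} = Set.Ico (a v) (b v))
    (hlen : Tendsto (fun v => b v - a v) atTop atTop) :
    ∀ (m : ℕ) (p : Fin (m + 1) → ℕ), StrictMono p →
      ∀ c : Fin (m + 1) → ℝ, (∀ i, 0 ≤ c i) → (∑ i, c i) = 1 →
        ∃ q : ℕ → ℕ, Tendsto q atTop atTop ∧
          ∀ A B : Set X, MeasurableSet A → MeasurableSet B →
            Tendsto (fun k => (μ ((⇑C.T)^[q k] '' A ∩ B)).toReal) atTop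
              (𝓝 (∑ i, c i * (μ ((⇑C.T)^[p i] '' A ∩ B)).toReal)) := by
  intro m p _ c hc hc1
  obtain ⟨D, hD, dense⟩ := ChaconAux.exists_dense_seq C
  obtain ⟨q, hq, h⟩ := ChaconAux.abstract_main C.measurePreserving
    (ChaconAux.height_tendsto C a b hinterval hlen) (ChaconAux.key C a b hinterval hlen)
    D hD dense m p c hc hc1
  refine ⟨q, hq, fun A B hA hB => ?_⟩
  have := h A B hA hB
  simpa only [ChaconAux.phi, ← ChaconAux.pw_nat, Measure.real] using this
end

section
/- The linear Chacon map T is not partially mixing: there is no α > 0 such that for all measurable sets A, B ⊆ X, liminf_{n→∞} μ(A ∩ T^nB) ≥ α μ(A)μ(B). -/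
open MeasureTheory Filter Topology
open scoped symmDiff

set_option linter.unusedSectionVars false

namespace ChaconMap

variable {X : Type*} [MeasurableSpace X] {μ : Measure X} [IsProbabilityMeasure μ]

/-- forward shift of a set by `T^n`, written as a preimage -/
def P {s : ℕ → ℕ} (C : ChaconMap μ s) (n : ℕ) (A : Set X) : Set X :=
  (⇑C.T.symm)^[n] ⁻¹' A

/-- union of levels -/
def S {s : ℕ → ℕ} (C : ChaconMap μ s) (j : ℕ) (J : Finset ℕ) : Set X :=
  ⋃ i ∈ J, C.P i (C.E j)

variable {s : ℕ → ℕ} (C : ChaconMap μ s)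

lemma image_eq (n : ℕ) (A : Set X) : (⇑C.T)^[n] '' A = C.P n A := by
  have h1 : Function.LeftInverse (⇑C.T.symm)^[n] (⇑C.T)^[n] :=
    Function.LeftInverse.iterate C.T.symm_apply_apply n
  have h2 : Function.RightInverse (⇑C.T.symm)^[n] (⇑C.T)^[n] :=
    Function.LeftInverse.iterate C.T.apply_symm_apply n
  exact congrFun (Set.image_eq_preimage_of_inverse h1 h2) A

lemma mpU : MeasurePreserving (⇑C.T.symm) μ μ := C.measurePreserving.symm C.T

lemma mp (n : ℕ) : MeasurePreserving ((⇑C.T.symm)^[n]) μ μ := C.mpU.iterate n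

lemma measP (n : ℕ) {A : Set X} (hA : MeasurableSet A) : MeasurableSet (C.P n A) :=
  (C.mp n).measurable hA

lemma realP (n : ℕ) {A : Set X} (hA : MeasurableSet A) : μ.real (C.P n A) = μ.real A := by
  unfold Measure.real P
  rw [(C.mp n).measure_preimage hA.nullMeasurableSet]

lemma P_ae (n : ℕ) {A B : Set X} (h : A =ᵐ[μ] B) : C.P n A =ᵐ[μ] C.P n B :=
  (C.mp n).quasiMeasurePreserving.preimage_ae_eq h

lemma P_P (n m : ℕ) (A : Set X) : C.P n (C.P m A) = C.P (n + m) A := by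
  unfold P
  rw [← Set.preimage_comp, ← Function.iterate_add, Nat.add_comm]

lemma P_inter (n : ℕ) (A B : Set X) : C.P n (A ∩ B) = C.P n A ∩ C.P n B := rfl

lemma P_union (n : ℕ) (A B : Set X) : C.P n (A ∪ B) = C.P n A ∪ C.P n B := rfl

lemma P_iUnion (n : ℕ) (J : Finset ℕ) (f : ℕ → Set X) :
    C.P n (⋃ i ∈ J, f i) = ⋃ i ∈ J, C.P n (f i) := by
  simp [P]

lemma P_mono (n : ℕ) {A B : Set X} (h : A ⊆ B) : C.P n A ⊆ C.P n B :=
  Set.preimage_mono h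

lemma measS (j : ℕ) (J : Finset ℕ) : MeasurableSet (C.S j J) :=
  Finset.measurableSet_biUnion _ fun i _ => C.measP i (C.measE j)

lemma st1 (j : ℕ) (hj : 1 ≤ j) : C.P (C.h j + 1) (C.E1 j) =ᵐ[μ] C.E2 j := by
  rw [← image_eq]; exact measure_symmDiff_eq_zero_iff.mp (C.stack1 j hj)

lemma st2 (j : ℕ) (hj : 1 ≤ j) : C.P (C.h j + 1 + s j) (C.E2 j) =ᵐ[μ] C.E3 j := by
  rw [← image_eq]; exact measure_symmDiff_eq_zero_iff.mp (C.stack2 j hj)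

lemma tdisj (j : ℕ) (hj : 1 ≤ j) (i : ℕ) (hi : i ≤ C.h j) (i' : ℕ) (hi' : i' ≤ C.h j)
    (hne : i ≠ i') : Disjoint (C.P i (C.E j)) (C.P i' (C.E j)) := by
  have := C.tower_disjoint j hj i hi i' hi' hne
  rwa [image_eq, image_eq] at this

lemma real_parts (j : ℕ) (hj : 1 ≤ j) : μ.real (C.E1 j) = μ.real (C.E j) / 3 ∧
    μ.real (C.E2 j) = μ.real (C.E j) / 3 ∧ μ.real (C.E3 j) = μ.real (C.E j) / 3 := by
  have h12 : μ.real (C.E1 j) = μ.real (C.E2 j) := by simp [Measure.real, C.E_meas12 j hj]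
  have h23 : μ.real (C.E2 j) = μ.real (C.E3 j) := by simp [Measure.real, C.E_meas23 j hj]
  have h : μ.real (C.E j) = μ.real (C.E1 j) + μ.real (C.E2 j) + μ.real (C.E3 j) := by
    rw [C.E_union j hj, measureReal_union _ (C.measE3 j), measureReal_union _ (C.measE2 j)]
    · exact C.E_disj12 j hj
    · exact Set.disjoint_union_left.mpr ⟨C.E_disj13 j hj, C.E_disj23 j hj⟩
  refine ⟨?_, ?_, ?_⟩ <;> linarith

lemma real_E_add (j : ℕ) (hj : 1 ≤ j) (d : ℕ) :
    μ.real (C.E (j + d)) = μ.real (C.E j) / 3 ^ d := by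
  induction d with
  | zero => simp
  | succ d ih =>
    rw [← add_assoc, C.E_next (j + d) (by omega), (C.real_parts (j + d) (by omega)).1, ih, pow_succ]
    field_simp

lemma E_sub_add (j : ℕ) (hj : 1 ≤ j) (d : ℕ) : C.E (j + d) ⊆ C.E j := by
  induction d with
  | zero => simp
  | succ d ih =>
    refine subset_trans ?_ ih
    rw [← add_assoc, C.E_next (j + d) (by omega), C.E_union (j + d) (by omega)]
    intro x hx; exact Or.inl (Or.inl hx)

lemma P_S (m j : ℕ) (J : Finset ℕ) : C.P m (C.S j J) = C.S j (J.image (fun i => i + m)) := by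
  unfold S
  rw [P_iUnion]
  simp only [P_P, Finset.mem_image]
  ext x
  simp only [Set.mem_iUnion, exists_prop]
  constructor
  · rintro ⟨i, hi, hx⟩
    exact ⟨i + m, ⟨i, hi, rfl⟩, by rwa [add_comm] at hx⟩
  · rintro ⟨_, ⟨i, hi, rfl⟩, hx⟩
    exact ⟨i, hi, by rwa [add_comm]⟩

/-- measure of a union of levels -/
lemma real_S (j : ℕ) (hj : 1 ≤ j) (J : Finset ℕ) (hJ : ∀ i ∈ J, i ≤ C.h j) :
    μ.real (C.S j J) = J.card * μ.real (C.E j) := by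
  unfold S
  rw [measureReal_biUnion_finset]
  · rw [Finset.sum_congr rfl fun i _ => C.realP i (C.measE j)]
    simp
  · intro i hi i' hi' hne
    exact C.tdisj j hj i (hJ i hi) i' (hJ i' hi') hne
  · intro i _; exact C.measP i (C.measE j)

lemma biUnion_ae (J : Finset ℕ) (f g : ℕ → Set X) (h : ∀ i ∈ J, f i =ᵐ[μ] g i) :
    (⋃ i ∈ J, f i : Set X) =ᵐ[μ] (⋃ i ∈ J, g i : Set X) :=
  Filter.EventuallyEq.countable_bUnion J.countable_toSet h

lemma refine_one (j : ℕ) (hj : 1 ≤ j) (J : Finset ℕ) (hJ : ∀ i ∈ J, i ≤ C.h j) :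
    ∃ J' : Finset ℕ, (∀ i ∈ J', i ≤ C.h (j + 1)) ∧ C.S j J =ᵐ[μ] C.S (j + 1) J' := by
  let a := C.h j + 1
  let b := C.h j + 1 + s j + (C.h j + 1)
  refine ⟨J ∪ J.image (fun i => i + a) ∪ J.image (fun i => i + b), ?_, ?_⟩
  · intro i hi
    rw [C.h_succ j hj]
    simp only [Finset.mem_union, Finset.mem_image, a, b] at hi
    rcases hi with (hi | ⟨k, hk, rfl⟩) | ⟨k, hk, rfl⟩
    · have := hJ i hi; omega
    · have := hJ k hk; omega
    · have := hJ k hk; omega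
  · have key : C.E j =ᵐ[μ] (C.E (j+1) ∪ C.P a (C.E (j+1)) ∪ C.P b (C.E (j+1)) : Set X) := by
      rw [C.E_union j hj, C.E_next j hj]
      have h2 := (C.st1 j hj).symm
      have h3 : C.E3 j =ᵐ[μ] C.P b (C.E1 j) := by
        refine (C.st2 j hj).symm.trans ?_
        have e : C.P b (C.E1 j) =
            C.P (C.h j + 1 + s j) (C.P (C.h j + 1) (C.E1 j)) := (C.P_P _ _ _).symm
        rw [e]
        exact C.P_ae _ h2
      exact ae_eq_set_union (ae_eq_set_union (ae_eq_refl _) h2) h3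
    have e : C.S (j+1) (J ∪ J.image (fun i => i + a) ∪ J.image (fun i => i + b)) =
        ⋃ i ∈ J, C.P i (C.E (j+1) ∪ C.P a (C.E (j+1)) ∪ C.P b (C.E (j+1))) := by
      ext x
      simp only [S, P_union, P_P, Set.mem_iUnion, Finset.mem_union, Finset.mem_image, Set.mem_union,
        exists_prop]
      constructor
      · rintro ⟨i, (hi | ⟨k, hk, rfl⟩) | ⟨k, hk, rfl⟩, hx⟩
        · exact ⟨i, hi, Or.inl (Or.inl hx)⟩
        · exact ⟨k, hk, Or.inl (Or.inr hx)⟩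
        · exact ⟨k, hk, Or.inr hx⟩
      · rintro ⟨i, hi, (hx | hx) | hx⟩
        · exact ⟨i, Or.inl (Or.inl hi), hx⟩
        · exact ⟨i + a, Or.inl (Or.inr ⟨i, hi, rfl⟩), hx⟩
        · exact ⟨i + b, Or.inr ⟨i, hi, rfl⟩, hx⟩
    rw [e]
    exact biUnion_ae _ _ _ fun i _ => C.P_ae i key

lemma refine_add (q : ℕ) (hq : 1 ≤ q) (d : ℕ) (J : Finset ℕ) (hJ : ∀ i ∈ J, i ≤ C.h q) :
    ∃ J' : Finset ℕ, (∀ i ∈ J', i ≤ C.h (q + d)) ∧ C.S q J =ᵐ[μ] C.S (q + d) J' := by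
  induction d with
  | zero => exact ⟨J, hJ, ae_eq_refl _⟩
  | succ d ih =>
    obtain ⟨J1, h1, h2⟩ := ih
    obtain ⟨J2, h3, h4⟩ := C.refine_one (q + d) (by omega) J1 h1
    exact ⟨J2, h3, h2.trans h4⟩

/-- The third column: its image after `H_j` steps. -/
lemma third (j : ℕ) (hj : 1 ≤ j) :
    C.P (C.h j + 1) (C.E3 j) =ᵐ[μ] C.P (C.h (j + 1) + 1) (C.E (j + 1)) := by
  have h3 : C.E3 j =ᵐ[μ] C.P (C.h j + 1 + s j) (C.P (C.h j + 1) (C.E1 j)) :=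
    (C.st2 j hj).symm.trans (C.P_ae _ (C.st1 j hj).symm)
  refine (C.P_ae _ h3).trans ?_
  rw [P_P, P_P, C.E_next j hj, C.h_succ j hj]
  apply Eq.eventuallyEq
  congr 1
  ring

/-- the middle column estimate -/
lemma middle (j : ℕ) (hj : 1 ≤ j) (d t : ℕ) (J J' : Finset ℕ) (hJ' : ∀ i ∈ J', i ≤ C.h j)
    (hJ : ∀ i ∈ J, i ≤ C.h j) :
    μ.real (C.P t (C.S j J) ∩ ⋃ i ∈ J', C.P i (C.E3 (j + d))) ≤
      (1 / 3 : ℝ) ^ (d + 1) * μ.real (C.S j J' ∩ C.P t (C.S j J)) +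
      (1 / 3 : ℝ) ^ (d + 1) * (t * μ.real (C.E j)) := by
  classical
  have hE3 : μ.real (C.E3 (j + d)) = (1 / 3 : ℝ) ^ (d + 1) * μ.real (C.E j) := by
    rw [(C.real_parts (j + d) (by omega)).2.2, C.real_E_add j hj d, pow_succ, one_div, inv_pow]
    field_simp
  have hE3sub : C.E3 (j + d) ⊆ C.E j := by
    refine subset_trans ?_ (C.E_sub_add j hj d)
    rw [C.E_union (j + d) (by omega)]
    exact Set.subset_union_right
  let G := J'.filter (fun i => t ≤ i ∧ i - t ∈ J)
  have hsub : (C.P t (C.S j J) ∩ ⋃ i ∈ J', C.P i (C.E3 (j + d))) ⊆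
      ⋃ i ∈ G ∪ Finset.range t, C.P i (C.E3 (j + d)) := by
    rintro x ⟨hx1, hx2⟩
    simp only [Set.mem_iUnion, exists_prop] at hx2 ⊢
    obtain ⟨i, hi, hx⟩ := hx2
    refine ⟨i, ?_, hx⟩
    by_cases hit : i < t
    · simp [hit]
    · push Not at hit
      refine Finset.mem_union_left _ (Finset.mem_filter.mpr ⟨hi, hit, ?_⟩)
      have hx' : x ∈ C.P t (C.P (i - t) (C.E j)) := by
        rw [C.P_P, Nat.add_sub_cancel' hit]
        exact C.P_mono i hE3sub hx
      unfold S at hx1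
      rw [C.P_iUnion] at hx1
      simp only [Set.mem_iUnion, exists_prop] at hx1
      obtain ⟨k, hk, hxk⟩ := hx1
      by_contra hcon
      have hne : k ≠ i - t := fun h => hcon (h ▸ hk)
      have hdis := C.tdisj j hj k (hJ k hk) (i - t) (by have := hJ' i hi; omega) hne
      exact Set.disjoint_left.mp hdis hxk hx'
  have h1 : μ.real (C.P t (C.S j J) ∩ ⋃ i ∈ J', C.P i (C.E3 (j + d))) ≤
      (G.card + t) * μ.real (C.E3 (j + d)) := by
    refine (measureReal_mono hsub (measure_ne_top _ _)).trans ?_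
    refine (measureReal_biUnion_finset_le _ _).trans ?_
    rw [Finset.sum_congr rfl fun i _ => C.realP i (C.measE3 (j + d))]
    rw [Finset.sum_const, nsmul_eq_mul]
    refine mul_le_mul_of_nonneg_right ?_ measureReal_nonneg
    have := Finset.card_union_le G (Finset.range t)
    rw [Finset.card_range] at this
    exact_mod_cast this
  have h2 : (G.card : ℝ) * μ.real (C.E j) ≤ μ.real (C.S j J' ∩ C.P t (C.S j J)) := by
    rw [← C.real_S j hj G fun i hi => hJ' i (Finset.mem_filter.mp hi).1]
    refine measureReal_mono ?_ (measure_ne_top _ _)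
    intro x hx
    simp only [S, Set.mem_iUnion, exists_prop] at hx
    obtain ⟨i, hi, hx⟩ := hx
    obtain ⟨hi1, hi2, hi3⟩ := Finset.mem_filter.mp hi
    refine ⟨Set.mem_biUnion hi1 hx, ?_⟩
    have hx' : x ∈ C.P t (C.P (i - t) (C.E j)) := by
      rwa [C.P_P, Nat.add_sub_cancel' hi2]
    exact C.P_mono t (Set.subset_biUnion_of_mem (u := fun i => C.P i (C.E j)) hi3) hx'
  rw [hE3] at h1
  have h3 := mul_le_mul_of_nonneg_left h2 (by positivity : (0:ℝ) ≤ (1 / 3 : ℝ) ^ (d + 1))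
  nlinarith [h1, h3]

lemma step_one (j : ℕ) (hj : 1 ≤ j) (d : ℕ) (J J' : Finset ℕ) (hJ' : ∀ i ∈ J', i ≤ C.h j)
    (hJ : ∀ i ∈ J, i ≤ C.h j) (hdis : μ.real (C.S j J ∩ C.S j J') = 0) :
    μ.real (C.S j J ∩ ⋃ i ∈ J', C.P i (C.P (C.h (j + d) + 1) (C.E (j + d)))) ≤
      (1 / 3 : ℝ) ^ (d + 1) * μ.real (C.S j J' ∩ C.P (s (j + d)) (C.S j J)) +
      (1 / 3 : ℝ) ^ (d + 1) * (s (j + d) * μ.real (C.E j)) +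
      μ.real (C.S j J ∩ ⋃ i ∈ J', C.P i (C.P (C.h (j + (d + 1)) + 1) (C.E (j + (d + 1))))) := by
  have hjd : 1 ≤ j + d := by omega
  set H := C.h (j + d) + 1 with hH
  set R := C.P (C.h (j + (d + 1)) + 1) (C.E (j + (d + 1))) with hR
  have hE : C.P H (C.E (j + d)) =ᵐ[μ]
      (C.E2 (j + d) ∪ C.P H (C.E2 (j + d)) ∪ R : Set X) := by
    rw [C.E_union (j + d) hjd, P_union, P_union]
    exact ae_eq_set_union (ae_eq_set_union (C.st1 _ hjd) (ae_eq_refl _)) (C.third _ hjd)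
  have hU := biUnion_ae (μ := μ) J' _ _ fun i _ => C.P_ae i hE
  have e : (⋃ i ∈ J', C.P i (C.E2 (j + d) ∪ C.P H (C.E2 (j + d)) ∪ R)) =
      (⋃ i ∈ J', C.P i (C.E2 (j + d))) ∪ (⋃ i ∈ J', C.P i (C.P H (C.E2 (j + d)))) ∪
      ⋃ i ∈ J', C.P i R := by
    simp only [P_union, Set.iUnion_union_distrib]
  rw [e] at hU
  have h0 : μ.real (C.S j J ∩ ⋃ i ∈ J', C.P i (C.P H (C.E (j + d)))) =
      μ.real (C.S j J ∩ ((⋃ i ∈ J', C.P i (C.E2 (j + d))) ∪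
        (⋃ i ∈ J', C.P i (C.P H (C.E2 (j + d)))) ∪ ⋃ i ∈ J', C.P i R)) :=
    measureReal_congr (ae_eq_set_inter (ae_eq_refl _) hU)
  rw [h0, Set.inter_union_distrib_left, Set.inter_union_distrib_left]
  refine (measureReal_union_le _ _).trans (add_le_add ?_ le_rfl)
  refine (measureReal_union_le _ _).trans ?_
  have hz : μ.real (C.S j J ∩ ⋃ i ∈ J', C.P i (C.E2 (j + d))) = 0 := by
    refine le_antisymm ?_ measureReal_nonneg
    rw [← hdis]
    refine measureReal_mono (Set.inter_subset_inter_right _ ?_) (measure_ne_top _ _)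
    refine Set.iUnion₂_mono fun i _ => C.P_mono i ?_
    refine subset_trans ?_ (C.E_sub_add j hj d)
    rw [C.E_union (j + d) hjd]
    exact subset_trans Set.subset_union_right Set.subset_union_left
  rw [hz, zero_add]
  have hmeas : MeasurableSet (C.S j J ∩ ⋃ i ∈ J', C.P i (C.P H (C.E2 (j + d)))) :=
    (C.measS j J).inter (Finset.measurableSet_biUnion _ fun i _ =>
      C.measP i (C.measP _ (C.measE2 _)))
  rw [← C.realP (s (j + d)) hmeas, P_inter, P_iUnion]
  have h3 : (⋃ i ∈ J', C.P (s (j + d)) (C.P i (C.P H (C.E2 (j + d)))) : Set X) =ᵐ[μ]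
      (⋃ i ∈ J', C.P i (C.E3 (j + d)) : Set X) := by
    refine biUnion_ae _ _ _ fun i _ => ?_
    have : C.P (s (j + d)) (C.P i (C.P H (C.E2 (j + d)))) =
        C.P i (C.P (H + s (j + d)) (C.E2 (j + d))) := by
      simp only [P_P]; congr 1; ring
    rw [this]
    exact C.P_ae i (C.st2 _ hjd)
  have h4 := measureReal_congr (ae_eq_set_inter (ae_eq_refl (C.P (s (j + d)) (C.S j J))) h3)
  refine h4.le.trans ?_
  exact C.middle j hj d _ J J' hJ' hJ

lemma step_many (j : ℕ) (hj : 1 ≤ j) (J J' : Finset ℕ) (hJ' : ∀ i ∈ J', i ≤ C.h j)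
    (hJ : ∀ i ∈ J, i ≤ C.h j) (hdis : μ.real (C.S j J ∩ C.S j J') = 0) (L : ℕ) :
    μ.real (C.S j J ∩ C.P (C.h j + 1) (C.S j J')) ≤
      ∑ d ∈ Finset.range L, ((1 / 3 : ℝ) ^ (d + 1) *
        μ.real (C.S j J' ∩ C.P (s (j + d)) (C.S j J)) +
      (1 / 3 : ℝ) ^ (d + 1) * (s (j + d) * μ.real (C.E j))) +
      (1 / 3 : ℝ) ^ L := by
  have key : ∀ L, μ.real (C.S j J ∩ C.P (C.h j + 1) (C.S j J')) ≤
      ∑ d ∈ Finset.range L, ((1 / 3 : ℝ) ^ (d + 1) *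
        μ.real (C.S j J' ∩ C.P (s (j + d)) (C.S j J)) +
      (1 / 3 : ℝ) ^ (d + 1) * (s (j + d) * μ.real (C.E j))) +
      μ.real (C.S j J ∩ ⋃ i ∈ J', C.P i (C.P (C.h (j + L) + 1) (C.E (j + L)))) := by
    intro L
    induction L with
    | zero =>
      simp only [Finset.range_zero, Finset.sum_empty, zero_add, add_zero]
      apply le_of_eq
      congr 2
      simp only [S, P_iUnion, P_P]
      simp only [Nat.add_comm]
    | succ L ih =>
      have := C.step_one j hj L J J' hJ' hJ hdis
      rw [Finset.sum_range_succ]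
      linarith
  refine (key L).trans (add_le_add le_rfl ?_)
  refine (measureReal_mono Set.inter_subset_right (measure_ne_top _ _)).trans ?_
  refine (measureReal_biUnion_finset_le _ _).trans ?_
  rw [Finset.sum_congr rfl fun i _ =>
    (C.realP i (C.measP _ (C.measE (j + L)))).trans (C.realP _ (C.measE (j + L)))]
  rw [Finset.sum_const, nsmul_eq_mul, C.real_E_add j hj L]
  have h1 : (J'.card : ℝ) * μ.real (C.E j) ≤ 1 := by
    rw [← C.real_S j hj J' hJ']; exact measureReal_le_one
  rw [one_div, inv_pow, ← mul_div_assoc, div_eq_mul_inv]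
  exact mul_le_of_le_one_left (by positivity) h1

lemma sum_third (L : ℕ) : ∑ d ∈ Finset.range L, (1 / 3 : ℝ) ^ (d + 1) ≤ 1 / 2 := by
  have : ∀ L : ℕ, ∑ d ∈ Finset.range L, (1 / 3 : ℝ) ^ (d + 1) = 1 / 2 - (1 / 2) * (1 / 3) ^ L := by
    intro L
    induction L with
    | zero => simp
    | succ L ih => rw [Finset.sum_range_succ, ih, pow_succ]; ring
  rw [this]
  have : (0:ℝ) ≤ (1 / 3) ^ L := by positivity
  linarith

end ChaconMap

namespace LinChacon

open ChaconMap

variable {X : Type*} [MeasurableSpace X] {μ : Measure X} [IsProbabilityMeasure μ]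
  (C : ChaconMap μ (fun j => j))

lemma step (q : ℕ) (hq : 1 ≤ q) (j : ℕ) (hj : q ≤ j) (I I' : Finset ℕ)
    (hI : ∀ i ∈ I, i ≤ C.h q) (hI' : ∀ i ∈ I', i ≤ C.h q)
    (hd : ∀ i ∈ I, i ∉ I') (L : ℕ) (x : ℝ)
    (hx : ∀ m < L, μ.real (C.S q I' ∩ C.P (j + m) (C.S q I)) ≤ x) (hx0 : 0 ≤ x) :
    μ.real (C.S q I ∩ C.P (C.h j + 1) (C.S q I')) ≤
      x / 2 + (j + L) * μ.real (C.E j) + (1 / 3 : ℝ) ^ L := by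
  obtain ⟨d, rfl⟩ := Nat.exists_eq_add_of_le hj
  set j := q + d
  obtain ⟨J, hJ, hIJ⟩ := C.refine_add q hq d I hI
  obtain ⟨J', hJ', hIJ'⟩ := C.refine_add q hq d I' hI'
  have hdis : μ.real (C.S j J ∩ C.S j J') = 0 := by
    rw [measureReal_congr (ae_eq_set_inter hIJ.symm hIJ'.symm)]
    have : C.S q I ∩ C.S q I' = ∅ := by
      rw [← Set.disjoint_iff_inter_eq_empty]
      unfold S
      simp only [Set.disjoint_iUnion_left, Set.disjoint_iUnion_right]
      intro i hi k hk
      first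
        | exact C.tdisj q hq i (hI i hi) k (hI' k hk) (fun h => hd i hi (h ▸ hk))
        | exact C.tdisj q hq k (hI k hk) i (hI' i hi) (fun h => hd k hk (h ▸ hi))
    rw [this]; simp
  rw [measureReal_congr (ae_eq_set_inter hIJ (C.P_ae _ hIJ'))]
  refine (C.step_many j (by omega) J J' hJ' hJ hdis L).trans (add_le_add ?_ le_rfl)
  have hb : ∀ m ∈ Finset.range L, ((1 / 3 : ℝ) ^ (m + 1) *
        μ.real (C.S j J' ∩ C.P (j + m) (C.S j J)) +
      (1 / 3 : ℝ) ^ (m + 1) * (((j + m : ℕ) : ℝ) * μ.real (C.E j))) ≤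
      (1 / 3 : ℝ) ^ (m + 1) * (x + (j + L) * μ.real (C.E j)) := by
    intro m hm
    rw [← mul_add]
    refine mul_le_mul_of_nonneg_left (add_le_add ?_ ?_) (by positivity)
    · rw [← measureReal_congr (ae_eq_set_inter hIJ' (C.P_ae _ hIJ))]
      exact hx m (Finset.mem_range.mp hm)
    · refine mul_le_mul_of_nonneg_right ?_ measureReal_nonneg
      have := (Finset.mem_range.mp hm).le
      push_cast
      have : (m : ℝ) ≤ L := by exact_mod_cast this
      linarith
  refine (Finset.sum_le_sum hb).trans ?_
  rw [← Finset.sum_mul]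
  have h0 : 0 ≤ ((j : ℝ) + L) * μ.real (C.E j) := mul_nonneg (by positivity) measureReal_nonneg
  have := mul_le_mul_of_nonneg_right (sum_third L) (add_nonneg hx0 h0)
  linarith

/-- iterated times -/
def g (C : ChaconMap μ (fun j => j)) : ℕ → ℕ → ℕ
  | 0, j => j
  | k + 1, j => C.h (g C k j) + 1

lemma le_h (j : ℕ) (hj : 1 ≤ j) : j ≤ C.h j := by
  induction j, hj using Nat.le_induction with
  | base => rw [C.h_one]
  | succ n hn ih => rw [C.h_succ n hn]; omega

lemma le_g (k j : ℕ) (hj : 1 ≤ j) : j ≤ g C k j := by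
  induction k with
  | zero => exact le_rfl
  | succ k ih =>
    have := le_h C (g C k j) (by omega)
    show j ≤ C.h (g C k j) + 1
    omega

lemma tendsto_g (k : ℕ) : Tendsto (g C k) atTop atTop := by
  refine tendsto_atTop_mono' atTop ?_ tendsto_id
  filter_upwards [eventually_ge_atTop 1] with j hj using le_g C k j hj

lemma real_E (j : ℕ) (hj : 1 ≤ j) : μ.real (C.E j) = 3 * μ.real (C.E 1) * (1 / 3) ^ j := by
  obtain ⟨d, rfl⟩ := Nat.exists_eq_add_of_le hj
  rw [C.real_E_add 1 le_rfl d, pow_add, one_div, inv_pow, inv_pow]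
  field_simp

lemma tendsto_poly (p : ℕ) :
    Tendsto (fun j : ℕ => (j : ℝ) ^ p * μ.real (C.E j)) atTop (𝓝 0) := by
  have h := (tendsto_pow_const_mul_const_pow_of_lt_one p (by norm_num : (0:ℝ) ≤ 1 / 3)
    (by norm_num : (1 / 3 : ℝ) < 1)).const_mul (3 * μ.real (C.E 1))
  rw [mul_zero] at h
  refine h.congr' ?_
  filter_upwards [eventually_ge_atTop 1] with j hj
  rw [real_E C j hj]; ring

lemma claim (q : ℕ) (hq : 1 ≤ q) (L : ℕ) (k : ℕ) : ∀ I I' : Finset ℕ,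
    (∀ i ∈ I, i + k * L ≤ C.h q) → (∀ i ∈ I', i + k * L ≤ C.h q) →
    (∀ i ∈ I, ∀ i' ∈ I', i + k * L < i' ∨ i' + k * L < i) →
    ∀ᶠ j in atTop, μ.real (C.S q I ∩ C.P (g C k j) (C.S q I')) ≤
      (1 / 2 : ℝ) ^ k + 4 * (1 / 3) ^ L := by
  induction k with
  | zero =>
    intro I I' _ _ _
    refine Eventually.of_forall fun j => measureReal_le_one.trans ?_
    have : (0:ℝ) ≤ (1 / 3) ^ L := by positivity
    rw [pow_zero]; linarith
  | succ k ih =>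
    intro I I' hI hI' hd
    have hkL : (k + 1) * L = k * L + L := by ring
    rw [hkL] at hI hI' hd
    have h1 : ∀ᶠ j in atTop, ∀ m ∈ Finset.range L,
        μ.real (C.S q I' ∩ C.P (g C k j) (C.S q (I.image (fun i => i + m)))) ≤
          (1 / 2 : ℝ) ^ k + 4 * (1 / 3) ^ L := by
      rw [Filter.eventually_all_finset]
      intro m hm
      have hm := Finset.mem_range.mp hm
      apply ih
      · intro i hi; have := hI' i hi; omega
      · intro i hi
        obtain ⟨i, hi0, rfl⟩ := Finset.mem_image.mp hi
        have := hI i hi0; omega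
      · intro i' hi' i hi
        obtain ⟨i, hi0, rfl⟩ := Finset.mem_image.mp hi
        have := hd i hi0 i' hi'; omega
    have h2 : ∀ᶠ j : ℕ in atTop, ((j : ℝ) + L) * μ.real (C.E j) ≤ (1 / 3 : ℝ) ^ L := by
      have ha := (tendsto_poly C 1).add ((tendsto_poly C 0).const_mul (L : ℝ))
      have hpos : (0 : ℝ) + L * 0 < (1 / 3 : ℝ) ^ L := by simp
      filter_upwards [ha.eventually_le_const hpos] with j hj
      simp only [pow_one, pow_zero] at hj
      linarith
    filter_upwards [h1, (tendsto_g C k).eventually h2,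
      (tendsto_g C k).eventually (eventually_ge_atTop q)] with j a1 a2 a3
    have := step C q hq (g C k j) a3 I I' (fun i hi => by have := hI i hi; omega)
      (fun i hi => by have := hI' i hi; omega)
      (fun i hi hi' => by have := hd i hi i hi'; omega) L
      ((1 / 2 : ℝ) ^ k + 4 * (1 / 3) ^ L)
      (fun m hm => by
        rw [← C.P_P, C.P_S]; exact a1 m (Finset.mem_range.mpr hm)) (by positivity)
    refine this.trans ?_
    rw [pow_succ]
    linarith

lemma full : Tendsto (fun j => ((C.h j : ℝ) + 1) * μ.real (C.E j)) atTop (𝓝 1) := by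
  have h := (ENNReal.tendsto_toReal ENNReal.one_ne_top).comp C.tower_full
  rw [ENNReal.toReal_one] at h
  refine h.congr' ?_
  filter_upwards [eventually_ge_atTop 1] with j hj
  have := C.real_S j hj (Finset.range (C.h j + 1)) (fun i hi => by
    have := Finset.mem_range.mp hi; omega)
  rw [Finset.card_range] at this
  push_cast at this
  rw [← this]
  simp only [Function.comp, S, Measure.real, image_eq]

lemma E1_pos : 0 < μ.real (C.E 1) := by
  rcases measureReal_nonneg.lt_or_eq with h | h
  · exact h
  · exfalso
    have h1 := full C
    have h2 : Tendsto (fun j => ((C.h j : ℝ) + 1) * μ.real (C.E j)) atTop (𝓝 0) := by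
      refine tendsto_const_nhds.congr' ?_
      filter_upwards [eventually_ge_atTop 1] with j hj
      rw [real_E C j hj, ← h]; simp
    exact zero_ne_one (tendsto_nhds_unique h2 h1)

lemma final (α : ℝ) (hα : 0 < α) : ∃ A B : Set X, MeasurableSet A ∧ MeasurableSet B ∧
    liminf (fun n => μ.real (A ∩ C.P n B)) atTop < α * μ.real A * μ.real B := by
  have e1 := E1_pos C
  have h1 : Tendsto (fun q : ℕ => ((C.h q : ℝ) + 1) * μ.real (C.E q)
      - (8 * ((q : ℝ) ^ 2 * μ.real (C.E q)) + (q : ℝ) ^ 0 * μ.real (C.E q))) atTop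
      (𝓝 (1 - (8 * 0 + 0))) :=
    (full C).sub (((tendsto_poly C 2).const_mul 8).add (tendsto_poly C 0))
  have h2 : Tendsto (fun q : ℕ => 5 * (3 / 4 : ℝ) ^ q) atTop (𝓝 (5 * 0)) :=
    (tendsto_pow_atTop_nhds_zero_of_lt_one (by norm_num) (by norm_num)).const_mul 5
  obtain ⟨q, hq, b1, b2⟩ := ((eventually_ge_atTop 1).and
    ((h1.eventually_const_lt (by norm_num : (1 / 2 : ℝ) < 1 - (8 * 0 + 0))).and
    (h2.eventually_lt_const (by rw [mul_zero]; positivity : 5 * 0 < α * (1 / 2) * (3 * μ.real (C.E 1)))))).exists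
  set r := 2 * q * (2 * q) with hr
  have hrq : (r : ℝ) = 4 * (q : ℝ) ^ 2 := by rw [hr]; push_cast; ring
  have hE : 0 < μ.real (C.E q) := by rw [real_E C q hq]; positivity
  have hlarge : 2 * r + 1 ≤ C.h q + 1 := by
    by_contra hcon
    push Not at hcon
    have : ((C.h q + 1 : ℕ) : ℝ) ≤ ((2 * r + 1 : ℕ) : ℝ) := by exact_mod_cast hcon.le
    push_cast at this
    rw [hrq] at this
    have := mul_le_mul_of_nonneg_right this hE.le
    simp only [pow_zero] at b1
    nlinarith
  set I := Finset.Ioc r (C.h q - r) with hI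
  set I' : Finset ℕ := {0} with hI'
  refine ⟨C.S q I, C.S q I', C.measS q I, C.measS q I', ?_⟩
  have hc := claim C q hq (2 * q) (2 * q) I I'
    (by intro i hi; rw [hI, Finset.mem_Ioc] at hi; omega)
    (by intro i hi; rw [hI', Finset.mem_singleton] at hi; omega)
    (by intro i hi i' hi'; rw [hI, Finset.mem_Ioc] at hi
        rw [hI', Finset.mem_singleton] at hi'; omega)
  have hle : liminf (fun n => μ.real (C.S q I ∩ C.P n (C.S q I'))) atTop ≤
      (1 / 2 : ℝ) ^ (2 * q) + 4 * (1 / 3) ^ (2 * q) := by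
    refine liminf_le_of_frequently_le ((tendsto_g C (2 * q)).frequently hc.frequently) ?_
    exact isBoundedUnder_of ⟨0, fun n => measureReal_nonneg⟩
  refine hle.trans_lt ?_
  have hA : μ.real (C.S q I) > 1 / 2 := by
    rw [C.real_S q hq I (by intro i hi; rw [hI, Finset.mem_Ioc] at hi; omega), hI, Nat.card_Ioc]
    have : ((C.h q - r - r : ℕ) : ℝ) = C.h q - 2 * r := by
      rw [Nat.cast_sub (by omega), Nat.cast_sub (by omega)]; ring
    rw [this, hrq]
    simp only [pow_zero] at b1
    nlinarith
  have hB : μ.real (C.S q I') = 3 * μ.real (C.E 1) * (1 / 3) ^ q := by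
    rw [C.real_S q hq I' (by intro i hi; rw [hI', Finset.mem_singleton] at hi; omega), hI',
      real_E C q hq]
    simp
  have c1 : (1 / 2 : ℝ) ^ (2 * q) + 4 * (1 / 3) ^ (2 * q) ≤ 5 * (3 / 4) ^ q * (1 / 3) ^ q := by
    have : (1 / 3 : ℝ) ^ (2 * q) ≤ (1 / 2) ^ (2 * q) := by gcongr; norm_num
    have e : (3 / 4 : ℝ) ^ q * (1 / 3) ^ q = (1 / 2) ^ (2 * q) := by
      rw [← mul_pow, pow_mul]; norm_num
    rw [mul_assoc, e]; linarith
  refine c1.trans_lt ?_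
  have c2 : 5 * (3 / 4 : ℝ) ^ q * (1 / 3) ^ q < α * (1 / 2) * (3 * μ.real (C.E 1)) * (1 / 3) ^ q :=
    mul_lt_mul_of_pos_right b2 (by positivity)
  refine c2.trans_le ?_
  rw [hB, mul_assoc (α * (1 / 2))]
  exact mul_le_mul_of_nonneg_right (mul_le_mul_of_nonneg_left hA.le hα.le) (by positivity)

end LinChacon

/-- the linear Chacon map is not partially mixing. -/
theorem linearChacon_not_partiallyMixing
    {X : Type*} [MeasurableSpace X] (μ : Measure X) [IsProbabilityMeasure μ]
    (C : ChaconMap μ (fun j => j)) :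
    ¬ ∃ α : ℝ, 0 < α ∧
        ∀ A B : Set X, MeasurableSet A → MeasurableSet B →
          α * (μ A).toReal * (μ B).toReal
            ≤ liminf (fun n => (μ (A ∩ (⇑C.T)^[n] '' B)).toReal) atTop := by
  rintro ⟨α, hα, h⟩
  obtain ⟨A, B, hA, hB, hlt⟩ := LinChacon.final C α hα
  have := h A B hA hB
  simp only [ChaconMap.image_eq] at this
  exact absurd this (not_le.mpr hlt)
end
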